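/- For every integer k ≥ 7, there is a 3-clause Achlioptas rule for random k-SAT (namely: select the first among the first 2 presented clauses that contains at least two positive literals, and otherwise select the 3rd clause) such that the formula Φ_m generated after m = ⌈2^k·(ln 2)·n⌉ steps is satisfiable with probability tending to 1 as n → ∞. -/

import Mathlib

open Finset Filter

/-- A literal over `n` variables: a variable together with a sign (`true` = positive). -/
abbrev Lit (n : ℕ) := Fin n × Bool

/-- A `k`-clause over `n` variables: a set of `k` literals on `k` distinct variables.
There are `C(n,k) * 2^k` such clauses. -/
abbrev Clause (n k : ℕ) :=
  {C : Finset (Lit n) // C.card = k ∧ (C.image Prod.fst).card = k}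

/-- The number of positive literals in a clause. -/
def Clause.posCount {n k : ℕ} (C : Clause n k) : ℕ :=
  (C.1.filter fun p => p.2 = true).card

/-- The assignment `σ` satisfies the clause `C`. -/
def Sat {n k : ℕ} (σ : Fin n → Bool) (C : Clause n k) : Prop :=
  ∃ p ∈ C.1, σ p.1 = p.2

/-- A formula (a finite sequence of clauses) is satisfiable. -/
def Satisfiable {n k m : ℕ} (Φ : Fin m → Clause n k) : Prop :=
  ∃ σ : Fin n → Bool, ∀ i, Sat σ (Φ i)

/-- The Achlioptas rule: select the first among the first `l - 1` presented clauses
containing at least two positive literals; if there is none, select the `l`-th clause. -/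
def select {n k l : ℕ} (hl : 0 < l) (cs : Fin l → Clause n k) : Clause n k :=
  match (List.finRange l).find? (fun i => decide (i.1 + 1 < l ∧ 2 ≤ (cs i).posCount)) with
  | some i => cs i
  | none => cs ⟨l - 1, Nat.sub_lt hl one_pos⟩

/-- The probability of the event `P` under the uniform distribution on the finite type `α`;
in particular, for `α = Fin m → Fin l → Clause n k` this is the probability that `P` holds
for `m` rounds of `l` clauses drawn independently and uniformly at random with replacement. -/
noncomputable def unifProb {α : Type*} [Fintype α] (P : α → Prop) : ℝ :=
  (Nat.card {a // P a} : ℝ) / (Fintype.card α : ℝ)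



/-! ### Basic finite probability -/

namespace KS

noncomputable def Ex {Ω : Type*} [Fintype Ω] (f : Ω → ℝ) : ℝ := (∑ ω, f ω) / Fintype.card Ω

open Classical in
noncomputable def ind (p : Prop) : ℝ := if p then 1 else 0

noncomputable def pr {Ω : Type*} [Fintype Ω] (P : Ω → Prop) : ℝ := Ex (fun ω => ind (P ω))

lemma ind_nonneg (p : Prop) : 0 ≤ ind p := by unfold ind; split_ifs <;> norm_num
lemma ind_le_one (p : Prop) : ind p ≤ 1 := by unfold ind; split_ifs <;> norm_num
lemma ind_true {p : Prop} (h : p) : ind p = 1 := by simp [ind, h]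
lemma ind_false {p : Prop} (h : ¬ p) : ind p = 0 := by simp [ind, h]
lemma ind_mono {p q : Prop} (h : p → q) : ind p ≤ ind q := by
  by_cases hp : p
  · rw [ind_true hp, ind_true (h hp)]
  · rw [ind_false hp]; exact ind_nonneg q
lemma ind_and (p q : Prop) : ind (p ∧ q) = ind p * ind q := by
  by_cases hp : p <;> by_cases hq : q <;> simp [ind, hp, hq]
lemma ind_or (p q : Prop) : ind (p ∨ q) ≤ ind p + ind q := by
  by_cases hp : p <;> by_cases hq : q <;> simp [ind, hp, hq]
lemma ind_forall {ι : Type*} [Fintype ι] (p : ι → Prop) : ind (∀ i, p i) = ∏ i, ind (p i) := by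
  by_cases h : ∀ i, p i
  · rw [ind_true h]; symm; apply Finset.prod_eq_one; intro i _; exact ind_true (h i)
  · rw [ind_false h]; push Not at h; obtain ⟨i, hi⟩ := h
    symm; exact Finset.prod_eq_zero (Finset.mem_univ i) (ind_false hi)
lemma ind_exists_le {ι : Type*} [Fintype ι] (p : ι → Prop) : ind (∃ i, p i) ≤ ∑ i, ind (p i) := by
  by_cases h : ∃ i, p i
  · obtain ⟨i, hi⟩ := h
    calc ind (∃ i, p i) ≤ 1 := ind_le_one _
      _ = ind (p i) := (ind_true hi).symm
      _ ≤ _ := Finset.single_le_sum (f := fun i => ind (p i)) (fun i _ => ind_nonneg _)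
        (Finset.mem_univ i)
  · rw [ind_false h]; exact Finset.sum_nonneg (fun i _ => ind_nonneg _)

section
variable {Ω : Type*} [Fintype Ω]

lemma Ex_mono {f g : Ω → ℝ} (h : ∀ ω, f ω ≤ g ω) : Ex f ≤ Ex g := by
  unfold Ex; gcongr; exact h _
lemma Ex_nonneg {f : Ω → ℝ} (h : ∀ ω, 0 ≤ f ω) : 0 ≤ Ex f := by
  unfold Ex; exact div_nonneg (Finset.sum_nonneg (fun i _ => h i)) (by positivity)
lemma Ex_const [Nonempty Ω] (c : ℝ) : Ex (fun _ : Ω => c) = c := by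
  unfold Ex; simp
lemma Ex_le_const [Nonempty Ω] {f : Ω → ℝ} {c : ℝ} (h : ∀ ω, f ω ≤ c) : Ex f ≤ c :=
  (Ex_mono h).trans_eq (Ex_const c)
lemma Ex_sum {ι : Type*} (s : Finset ι) (f : ι → Ω → ℝ) :
    Ex (fun ω => ∑ i ∈ s, f i ω) = ∑ i ∈ s, Ex (f i) := by
  unfold Ex; rw [Finset.sum_comm, Finset.sum_div]
lemma Ex_add (f g : Ω → ℝ) : Ex (fun ω => f ω + g ω) = Ex f + Ex g := by
  unfold Ex; rw [Finset.sum_add_distrib, add_div]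
lemma Ex_mul_left (c : ℝ) (f : Ω → ℝ) : Ex (fun ω => c * f ω) = c * Ex f := by
  unfold Ex; rw [← Finset.mul_sum, mul_div_assoc]
lemma pr_mono {P Q : Ω → Prop} (h : ∀ ω, P ω → Q ω) : pr P ≤ pr Q := Ex_mono fun ω => ind_mono (h ω)
lemma pr_nonneg (P : Ω → Prop) : 0 ≤ pr P := Ex_nonneg fun _ => ind_nonneg _
lemma pr_le_one [Nonempty Ω] (P : Ω → Prop) : pr P ≤ 1 := Ex_le_const fun _ => ind_le_one _
lemma pr_or (P Q : Ω → Prop) : pr (fun ω => P ω ∨ Q ω) ≤ pr P + pr Q := by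
  unfold pr; rw [← Ex_add]; exact Ex_mono fun ω => ind_or _ _
lemma pr_exists {ι : Type*} [Fintype ι] (P : ι → Ω → Prop) :
    pr (fun ω => ∃ i, P i ω) ≤ ∑ i, pr (P i) := by
  unfold pr; rw [← Ex_sum]; exact Ex_mono fun ω => ind_exists_le _
open Classical in
lemma pr_eq (P : Ω → Prop) : pr P = ((Finset.univ.filter P).card : ℝ) / Fintype.card Ω := by
  unfold pr Ex ind; simp

lemma Ex_equiv {Ω' : Type*} [Fintype Ω'] (e : Ω ≃ Ω') (f : Ω' → ℝ) :
    Ex (fun ω => f (e ω)) = Ex f := by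
  unfold Ex; rw [Equiv.sum_comp e f, Fintype.card_congr e]

lemma Ex_prod {Ω' : Type*} [Fintype Ω'] (f : Ω × Ω' → ℝ) :
    Ex f = Ex (fun a => Ex (fun b => f (a, b))) := by
  unfold Ex; rw [Fintype.sum_prod_type, Fintype.card_prod, ← Finset.sum_div, div_div]
  push_cast; rw [mul_comm]

lemma Ex_mix [Nonempty Ω] (mix : Ω → Ω → Ω) (h : ∀ a b, mix (mix a b) (mix b a) = a)
    (F : Ω → ℝ) : Ex F = Ex (fun a => Ex (fun b => F (mix a b))) := by
  let e : Ω × Ω ≃ Ω × Ω :=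
    { toFun := fun x => (mix x.1 x.2, mix x.2 x.1)
      invFun := fun x => (mix x.1 x.2, mix x.2 x.1)
      left_inv := fun x => by simp [h]
      right_inv := fun x => by simp [h] }
  have h1 := Ex_equiv e (fun x : Ω × Ω => F x.1)
  rw [Ex_prod, Ex_prod] at h1
  simp only [Ex_const] at h1
  exact h1.symm

end

/-- marginalisation along an injection of index types -/
lemma Ex_marg {ι ι' Y : Type*} [Fintype ι] [DecidableEq ι] [Fintype ι'] [DecidableEq ι']
    [Fintype Y] [Nonempty Y]
    (e : ι' → ι) (he : Function.Injective e) (F : (ι' → Y) → ℝ) :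
    Ex (fun ω : ι → Y => F (fun i => ω (e i))) = Ex F := by
  let E : (ι → Y) × (ι' → Y) ≃ (ι → Y) × (ι' → Y) :=
    { toFun := fun x => (Function.extend e x.2 x.1, fun i => x.1 (e i))
      invFun := fun x => (Function.extend e x.2 x.1, fun i => x.1 (e i))
      left_inv := fun x => by
        ext i
        · by_cases hi : ∃ j, e j = i
          · obtain ⟨j, rfl⟩ := hi; simp [he.extend_apply]
          · simp [Function.extend_apply' _ _ _ hi]
        · simp [he.extend_apply]
      right_inv := fun x => by
        ext i
        · by_cases hi : ∃ j, e j = i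
          · obtain ⟨j, rfl⟩ := hi; simp [he.extend_apply]
          · simp [Function.extend_apply' _ _ _ hi]
        · simp [he.extend_apply] }
  have h1 := Ex_equiv E (fun x : (ι → Y) × (ι' → Y) => F x.2)
  rw [Ex_prod, Ex_prod] at h1
  have h2 : ∀ a b, (E (a, b)).2 = fun i => a (e i) := fun _ _ => rfl
  simp only [h2, Ex_const] at h1
  exact h1

lemma Ex_pi {ι Y : Type*} [Fintype ι] [DecidableEq ι] [Fintype Y] (g : ι → Y → ℝ) :
    Ex (fun ω : ι → Y => ∏ i, g i (ω i)) = ∏ i, Ex (g i) := by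
  unfold Ex
  rw [Finset.prod_div_distrib, Finset.prod_univ_sum, Fintype.piFinset_univ]
  simp

lemma pr_pi {ι Y : Type*} [Fintype ι] [DecidableEq ι] [Fintype Y] (g : ι → Y → Prop) :
    pr (fun ω : ι → Y => ∀ i, g i (ω i)) = ∏ i, pr (g i) := by
  unfold pr; rw [← Ex_pi]; congr 1; ext ω; exact ind_forall _

lemma pr_mem {Y : Type*} [Fintype Y] (s : Finset Y) :
    pr (fun y => y ∈ s) = (s.card : ℝ) / Fintype.card Y := by
  classical
  rw [pr_eq]; congr 2; congr 1; ext; simp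

open Classical in
/-- binomial tail -/
lemma tail {ι X : Type*} [Fintype ι] [DecidableEq ι] [Fintype X] [Nonempty X]
    (T : Finset ι) (E : ι → X → Prop) (ρ t : ℝ) (ht : 0 < t)
    (hE : ∀ i ∈ T, pr (E i) ≤ ρ) (K : ℕ) :
    pr (fun ω : ι → X => K ≤ (T.filter fun i => E i (ω i)).card) ≤
      (1 + t * ρ) ^ T.card / (1 + t) ^ K := by
  have h1 : ∀ ω : ι → X, ind (K ≤ (T.filter fun i => E i (ω i)).card) * (1 + t) ^ K ≤
      ∏ i, (if i ∈ T then 1 + t * ind (E i (ω i)) else 1) := by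
    intro ω
    rw [Finset.prod_ite]
    simp only [Finset.prod_const_one, mul_one, Finset.filter_mem_eq_inter, Finset.univ_inter]
    have h2 : ∏ i ∈ T, (1 + t * ind (E i (ω i))) = (1 + t) ^ (T.filter fun i => E i (ω i)).card := by
      rw [← Finset.prod_const, Finset.prod_filter]
      apply Finset.prod_congr rfl
      intro i _
      unfold ind; split_ifs <;> simp
    rw [h2]
    by_cases h : K ≤ (T.filter fun i => E i (ω i)).card
    · rw [ind_true h, one_mul]
      exact pow_le_pow_right₀ (by linarith) h
    · rw [ind_false h, zero_mul]; positivity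
  rw [le_div_iff₀ (by positivity)]
  unfold pr
  rw [mul_comm, ← Ex_mul_left]
  calc _ ≤ Ex (fun ω : ι → X => ∏ i, (if i ∈ T then 1 + t * ind (E i (ω i)) else 1)) := by
        apply Ex_mono; intro ω; rw [mul_comm]; exact h1 ω
    _ = ∏ i, Ex (fun x : X => if i ∈ T then 1 + t * ind (E i x) else 1) :=
        Ex_pi (fun i x => if i ∈ T then 1 + t * ind (E i x) else 1)
    _ ≤ ∏ i, (if i ∈ T then 1 + t * ρ else 1) := by
        apply Finset.prod_le_prod
        · intro i _; apply Ex_nonneg; intro x; split_ifs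
          · have := ind_nonneg (E i x); positivity
          · norm_num
        · intro i _
          split_ifs with h
          · rw [Ex_add, Ex_const, Ex_mul_left]
            have := hE i h; unfold pr at this; gcongr
          · rw [Ex_const]
    _ = _ := by rw [Finset.prod_ite]; simp

open Classical in
/-- uniform exponential tail bound -/
lemma tail_exp (s δ : ℝ) (hs : 0 ≤ s) (hδ : 0 < δ) : ∃ c : ℝ, 0 < c ∧
    ∀ {ι X : Type} [Fintype ι] [DecidableEq ι] [Fintype X] [Nonempty X]
      (T : Finset ι) (E : ι → X → Prop) (ρ : ℝ) (n : ℕ), 0 ≤ ρ →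
      (∀ i ∈ T, pr (E i) ≤ ρ) → ρ * T.card ≤ s * n →
      pr (fun ω : ι → X => (s + δ) * n ≤ ((T.filter fun i => E i (ω i)).card : ℝ)) ≤
        Real.exp (-(c * n)) := by
  obtain ⟨t, ht, hts⟩ : ∃ t : ℝ, 0 < t ∧ s * t < δ := by
    refine ⟨δ / (s + 1), by positivity, ?_⟩
    rw [mul_div_assoc', div_lt_iff₀ (by linarith)]; nlinarith
  have hlog : t / (1 + t) ≤ Real.log (1 + t) := by
    have := Real.one_sub_inv_le_log_of_pos (show 0 < 1 + t by linarith)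
    have h2 : 1 - (1 + t)⁻¹ = t / (1 + t) := by field_simp; ring
    linarith
  refine ⟨(s + δ) * Real.log (1 + t) - s * t, ?_, ?_⟩
  · have h3 : s * t < (s + δ) * (t / (1 + t)) := by
      rw [mul_div_assoc', lt_div_iff₀ (by linarith)]; nlinarith
    have : (s + δ) * (t / (1 + t)) ≤ (s + δ) * Real.log (1 + t) := by gcongr
    linarith
  · intro ι X _ _ _ _ T E ρ n hρ hE hT
    have h4 := tail T E ρ t ht hE ⌈(s + δ) * n⌉₊
    have h5 : pr (fun ω : ι → X => (s + δ) * n ≤ ((T.filter fun i => E i (ω i)).card : ℝ)) ≤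
        pr (fun ω : ι → X => ⌈(s + δ) * n⌉₊ ≤ (T.filter fun i => E i (ω i)).card) :=
      pr_mono fun ω h => Nat.ceil_le.2 h
    refine (h5.trans h4).trans ?_
    have h6 : (1 + t * ρ) ^ T.card ≤ Real.exp (s * t * n) := by
      calc (1 + t * ρ) ^ T.card ≤ (Real.exp (t * ρ)) ^ T.card := by
            gcongr; linarith [Real.add_one_le_exp (t * ρ)]
        _ = Real.exp (t * (ρ * T.card)) := by rw [← Real.exp_nat_mul]; ring_nf
        _ ≤ _ := by
            apply Real.exp_le_exp.2
            calc t * (ρ * T.card) ≤ t * (s * n) := by gcongr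
              _ = _ := by ring
    have h7 : Real.exp ((s + δ) * Real.log (1 + t) * n) ≤ (1 + t) ^ ⌈(s + δ) * n⌉₊ := by
      have hl : 0 ≤ Real.log (1 + t) := Real.log_nonneg (by linarith)
      calc Real.exp ((s + δ) * Real.log (1 + t) * n)
          = Real.exp (((s + δ) * n) * Real.log (1 + t)) := by ring_nf
        _ ≤ Real.exp ((⌈(s + δ) * n⌉₊ : ℝ) * Real.log (1 + t)) := by
            apply Real.exp_le_exp.2; gcongr; exact Nat.le_ceil _
        _ = _ := by rw [Real.exp_nat_mul, Real.exp_log (by linarith)]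
    calc _ ≤ Real.exp (s * t * n) / Real.exp ((s + δ) * Real.log (1 + t) * n) := by
          gcongr
      _ = _ := by rw [← Real.exp_sub]; congr 1; ring

end KS

/-! ### A 2-SAT certificate -/

namespace KS

section TwoSat
variable {V : Type*}

def ng (a : V × Bool) : V × Bool := (a.1, !a.2)

lemma ng_ng (a : V × Bool) : ng (ng a) = a := by simp [ng]
lemma ng_ne (a : V × Bool) : ng a ≠ a := by
  intro h; have := congrArg Prod.snd h; simp [ng] at this
lemma eq_or_ng {a b : V × Bool} (h : a.1 = b.1) : b = a ∨ b = ng a := by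
  obtain ⟨a1, a2⟩ := a; obtain ⟨b1, b2⟩ := b; simp only at h; subst h
  cases a2 <;> cases b2 <;> simp [ng]

variable (Imp : V × Bool → V × Bool → Prop)

lemma reach_ng (hsk : ∀ a b, Imp a b → Imp (ng b) (ng a)) {a b : V × Bool}
    (h : Relation.ReflTransGen Imp a b) : Relation.ReflTransGen Imp (ng b) (ng a) := by
  induction h with
  | refl => exact .refl
  | tail _ h2 ih => exact .head (hsk _ _ h2) ih

def IsWalk (z : ℕ → V × Bool) (n : ℕ) : Prop := ∀ i, i < n → Imp (z i) (z (i + 1))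

lemma walk_reach {z : ℕ → V × Bool} {n : ℕ} (h : IsWalk Imp z n) (i j : ℕ) (hij : i ≤ j)
    (hj : j ≤ n) : Relation.ReflTransGen Imp (z i) (z j) := by
  induction j, hij using Nat.le_induction with
  | base => exact .refl
  | succ j _ ih => exact .tail (ih (by omega)) (h j (by omega))

lemma reach_walk {a b : V × Bool} (h : Relation.ReflTransGen Imp a b) :
    ∃ (z : ℕ → V × Bool) (n : ℕ), IsWalk Imp z n ∧ z 0 = a ∧ z n = b := by
  induction h with
  | refl => exact ⟨fun _ => a, 0, fun i hi => by omega, rfl, rfl⟩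
  | @tail b c _ h2 ih =>
    obtain ⟨z, n, hw, h0, hn⟩ := ih
    refine ⟨fun i => if i ≤ n then z i else c, n + 1, ?_, by simp [h0], by simp⟩
    intro i hi
    by_cases h : i = n
    · subst h; simp [hn, h2]
    · have h1 : i ≤ n := by omega
      have h3 : i + 1 ≤ n := by omega
      simp only [h1, h3, if_true]; exact hw i (by omega)

lemma exists_assign [Finite V] (hsk : ∀ a b, Imp a b → Imp (ng b) (ng a))
    (hno : ∀ a, ¬ (Relation.ReflTransGen Imp a (ng a) ∧ Relation.ReflTransGen Imp (ng a) a)) :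
    ∃ τ : V → Bool, ∀ v w d, Imp (v, τ v) (w, d) → τ w = d := by
  classical
  let good : Set (Set (V × Bool)) :=
    {C | (∀ a b, a ∈ C → Imp a b → b ∈ C) ∧ (∀ a, a ∈ C → ng a ∉ C)}
  have hg : (∅ : Set (V × Bool)) ∈ good := ⟨by simp, by simp⟩
  obtain ⟨C, -, hC⟩ := (Set.toFinite good).exists_le_maximal hg
  have hcl := hC.1.1
  have hco := hC.1.2
  have hreach : ∀ a b, a ∈ C → Relation.ReflTransGen Imp a b → b ∈ C := by
    intro a b ha h
    induction h with
    | refl => exact ha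
    | tail _ h2 ih => exact hcl _ _ ih h2
  have key : ∀ a : V × Bool, ¬ Relation.ReflTransGen Imp a (ng a) → a ∈ C ∨ ng a ∈ C := by
    intro a ha
    by_contra hcon
    push Not at hcon
    have h1 : C ∪ {b | Relation.ReflTransGen Imp a b} ∈ good := by
      refine ⟨?_, ?_⟩
      · rintro b c (hb | hb) hbc
        · exact Or.inl (hcl _ _ hb hbc)
        · exact Or.inr (Relation.ReflTransGen.tail hb hbc)
      · rintro b (hb | hb) (hb' | hb')
        · exact hco _ hb hb'
        · have := reach_ng Imp hsk hb'
          rw [ng_ng] at this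
          exact hcon.2 (hreach _ _ hb this)
        · have := reach_ng Imp hsk hb
          exact hcon.2 (hreach _ _ hb' this)
        · have := reach_ng Imp hsk hb'
          rw [ng_ng] at this
          exact ha (Relation.ReflTransGen.trans hb this)
    have h2 := hC.2 h1 Set.subset_union_left
    exact hcon.1 (h2 (Or.inr Relation.ReflTransGen.refl))
  have hall : ∀ v, (v, true) ∈ C ∨ (v, false) ∈ C := by
    intro v
    by_cases h : Relation.ReflTransGen Imp (v, true) (v, false)
    · have h' : ¬ Relation.ReflTransGen Imp (v, false) (ng (v, false)) := fun h2 =>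
        hno (v, true) ⟨h, h2⟩
      exact (key _ h').symm
    · exact key (v, true) h
  refine ⟨fun v => decide ((v, true) ∈ C), ?_⟩
  intro v w d h
  have h1 : (v, decide ((v, true) ∈ C)) ∈ C := by
    by_cases hv : (v, true) ∈ C
    · simp [hv]
    · have := (hall v).resolve_left hv; simp [hv, this]
  have h2 := hcl _ _ h1 h
  cases d
  · have := hco _ h2; simpa [ng] using this
  · simpa using h2

theorem twoSat_cert [Finite V] (hsk : ∀ a b, Imp a b → Imp (ng b) (ng a))
    (hno : ¬ ∃ τ : V → Bool, ∀ v w d, Imp (v, τ v) (w, d) → τ w = d) :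
    ∃ (z : ℕ → V × Bool) (s L : ℕ), 1 ≤ s ∧ s < L ∧ (∀ i, i < L → Imp (z i) (z (i + 1))) ∧
      z s = ng (z 0) ∧ (∀ i j, 1 ≤ i → i < j → j < L → (z i).1 ≠ (z j).1) ∧
      ∃ j, 1 ≤ j ∧ j < L ∧ (z L).1 = (z j).1 := by
  classical
  have h0 : ∃ a, Relation.ReflTransGen Imp a (ng a) ∧ Relation.ReflTransGen Imp (ng a) a := by
    by_contra h; push Not at h
    exact hno (exists_assign Imp hsk fun a ha => h a ha.1 ha.2)
  let Pr : ℕ → Prop := fun s => ∃ z : ℕ → V × Bool, IsWalk Imp z s ∧ z s = ng (z 0) ∧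
    Relation.ReflTransGen Imp (ng (z 0)) (z 0)
  have hP : ∃ s, Pr s := by
    obtain ⟨a, h1, h2⟩ := h0
    obtain ⟨z, n, hw, hz0, hzn⟩ := reach_walk Imp h1
    exact ⟨n, z, hw, by rw [hzn, hz0], by rw [hz0]; exact h2⟩
  set s := Nat.find hP with hs
  obtain ⟨z, hw, hzs, hback⟩ := Nat.find_spec hP
  rw [← hs] at hw hzs
  have hmin : ∀ s', s' < s → ¬ Pr s' := fun s' h => Nat.find_min hP h
  have hs1 : 1 ≤ s := by
    by_contra h
    have : s = 0 := by omega
    rw [this] at hzs; exact ng_ne _ hzs.symm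
  have hdist : ∀ i j, 1 ≤ i → i < j → j ≤ s → (z i).1 ≠ (z j).1 := by
    intro i j hi hij hj he
    rcases eq_or_ng he with h | h
    · apply hmin (s - (j - i)) (by omega)
      refine ⟨fun x => if x ≤ i then z x else z (x + (j - i)), ?_, ?_, ?_⟩
      · intro x hx
        by_cases hxi : x < i
        · have h1 : x ≤ i := by omega
          have h2 : x + 1 ≤ i := by omega
          simp only [h1, h2, if_true]; exact hw x (by omega)
        · by_cases hxe : x = i
          · subst hxe
            have h2 : ¬ (x + 1 ≤ x) := by omega
            simp only [le_refl, h2, if_true, if_false]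
            rw [← h, show x + 1 + (j - x) = j + 1 by omega]
            exact hw j (by omega)
          · have h1 : ¬ x ≤ i := by omega
            have h2 : ¬ x + 1 ≤ i := by omega
            simp only [h1, h2, if_false]
            rw [show x + 1 + (j - i) = x + (j - i) + 1 by omega]
            exact hw _ (by omega)
      · by_cases hsj : s - (j - i) ≤ i
        · have : j = s := by omega
          subst this
          have h1 : s - (s - i) = i := by omega
          simp only [h1, le_refl, if_true, Nat.zero_le]
          rw [← h, hzs]
        · simp only [hsj, if_false, Nat.zero_le, if_true]
          rw [show s - (j - i) + (j - i) = s by omega, hzs]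
      · simpa using hback
    · apply hmin (j - i) (by omega)
      refine ⟨fun x => z (i + x), ?_, ?_, ?_⟩
      · intro x hx; exact hw (i + x) (by omega)
      · simp only [add_zero]; rw [show i + (j - i) = j by omega, h]
      · simp only [add_zero]
        rw [← h]
        refine (walk_reach Imp hw j s hj le_rfl).trans ?_
        rw [hzs]
        exact hback.trans (walk_reach Imp hw 0 i (by omega) (by omega))
  obtain ⟨w, T, hwW, hw0, hwT⟩ := reach_walk Imp hback
  let y : ℕ → V × Bool := fun i => if i ≤ s then z i else w (i - s)
  have hyle : ∀ i, i ≤ s → y i = z i := fun i hi => by simp [y, hi]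
  have hyge : ∀ i, s ≤ i → y i = w (i - s) := fun i hi => by
    by_cases h : i = s
    · subst h; simp [y, hw0, hzs]
    · have : ¬ i ≤ s := by omega
      simp [y, this]
  have hyW : IsWalk Imp y (s + T) := by
    intro i hi
    by_cases h : i < s
    · rw [hyle i (by omega), hyle (i + 1) (by omega)]; exact hw i h
    · rw [hyge i (by omega), hyge (i + 1) (by omega), show i + 1 - s = i - s + 1 by omega]
      exact hwW _ (by omega)
  have hT : 1 ≤ T := by
    by_contra h
    have : T = 0 := by omega
    subst this; rw [hw0] at hwT; exact ng_ne _ hwT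
  have hex : ∃ L, s < L ∧ ∃ j, 1 ≤ j ∧ j < L ∧ (y L).1 = (y j).1 := by
    refine ⟨s + T, by omega, s, hs1, by omega, ?_⟩
    rw [hyge _ (by omega), hyle s le_rfl, hzs, show s + T - s = T by omega, hwT]; rfl
  obtain ⟨hL1, hL2⟩ := Nat.find_spec hex
  have hLT : Nat.find hex ≤ s + T := Nat.find_min' hex (by
    refine ⟨by omega, s, hs1, by omega, ?_⟩
    rw [hyge _ (by omega), hyle s le_rfl, hzs, show s + T - s = T by omega, hwT]; rfl)
  refine ⟨y, s, Nat.find hex, hs1, hL1, fun i hi => hyW i (by omega), ?_, ?_, hL2⟩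
  · rw [hyle s le_rfl, hyle 0 (by omega), hzs]
  · intro i j hi hij hj he
    by_cases hjs : j ≤ s
    · rw [hyle i (by omega), hyle j hjs] at he
      exact hdist i j hi hij hjs he
    · exact Nat.find_min hex hj ⟨by omega, i, hi, hij, he.symm⟩

end TwoSat

end KS

/-! ### Core structure: deterministic part -/

namespace KS

section Core
variable {n m : ℕ} (kind : Fin m → ℕ) (A : Finset (Fin m)) (ω : Fin m → Fin 6 → Fin n)

open Classical in
noncomputable def SS : Finset (Fin n) := univ.filter fun v => ∃ i, kind i = 0 ∧ ω i 0 = v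
open Classical in
noncomputable def KK : Finset (Fin n) := univ.filter fun v => ∃ i, kind i = 0 ∧ ω i 5 = v
open Classical in
noncomputable def II : Finset (Fin n) := univ.filter fun v => v ∉ SS kind ω ∧ v ∉ KK kind ω ∧
  ∃ p, p ∉ A ∧ kind p = 2 ∧ ((ω p 0 = v ∧ ω p 1 ∈ SS kind ω) ∨ (ω p 1 = v ∧ ω p 0 ∈ SS kind ω))
noncomputable def HH : Finset (Fin n) := SS kind ω ∪ KK kind ω ∪ II kind A ω

def badx (H : Finset (Fin n)) (x : Fin 6 → Fin n) : Prop :=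
  ∀ j : Fin 6, j ≠ 0 → j ≠ 5 → x j ∈ H

open Classical in
noncomputable def sidx (H : Finset (Fin n)) (x : Fin 6 → Fin n) : Fin 6 :=
  if h : ∃ j : Fin 6, j ≠ 0 ∧ j ≠ 5 ∧ x j ∉ H then h.choose else 5

lemma sidx_ne (H : Finset (Fin n)) (x : Fin 6 → Fin n) : sidx H x ≠ 0 := by
  unfold sidx; split_ifs with h
  · exact h.choose_spec.1
  · decide

lemma sidx_cases (H : Finset (Fin n)) (x : Fin 6 → Fin n) :
    (x (sidx H x) ∉ H) ∨ (sidx H x = 5 ∧ badx H x) := by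
  unfold sidx; split_ifs with h
  · exact Or.inl h.choose_spec.2.2
  · right; refine ⟨rfl, ?_⟩
    push Not at h; exact h

/-- the two ends of a block -/
noncomputable def en (i : Fin m) (o : Bool) : Fin n :=
  if o then ω i 0 else ω i (sidx (HH kind A ω) (ω i))

open Classical in
noncomputable def PP : Finset (Fin n) :=
  univ.filter fun v => ∃ i o, kind i = 0 ∧ en kind A ω i o = v

def Pint (p : Fin m) : Prop :=
  2 ≤ kind p ∧ ∀ j : Fin 6, j.1 < kind p → ω p j ∈ PP kind ∅ ω

def rt (p : Fin m) (d : Bool) : Fin n := ω p (if d then 1 else 0)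
def lf (p : Fin m) (d : Bool) : Fin n := ω p (if d then 0 else 1)

lemma lf_not (p : Fin m) (d : Bool) : lf ω p (!d) = rt ω p d := by cases d <;> rfl
lemma rt_not (p : Fin m) (d : Bool) : rt ω p (!d) = lf ω p d := by cases d <;> rfl

def ImpR (a b : {p // Pint kind ω p} × Bool) : Prop :=
  ∃ i o, kind i = 0 ∧ rt ω a.1.1 a.2 = en kind ∅ ω i o ∧ lf ω b.1.1 b.2 = en kind ∅ ω i (!o)

def BadE : Prop := (∀ i, Function.Injective (ω i)) ∧ ¬ ∃ σ : Fin n → Bool,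
  (∀ i, kind i = 0 → ∃ j, σ (ω i j) = false) ∧
  (∀ i, kind i ≠ 0 → ∃ j : Fin 6, j.1 < kind i ∧ σ (ω i j) = true)

lemma ImpR_skew (a b) (h : ImpR kind ω a b) : ImpR kind ω (ng b) (ng a) := by
  obtain ⟨i, o, hi, h1, h2⟩ := h
  refine ⟨i, !o, hi, ?_, ?_⟩
  · simp only [ng]; rw [rt_not, h2]
  · simp only [ng, Bool.not_not]; rw [lf_not, h1]

lemma en_mem {i : Fin m} (hi : kind i = 0) (o : Bool) : en kind A ω i o ∈ PP kind A ω := by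
  simp only [PP, mem_filter, mem_univ, true_and]; exact ⟨i, o, hi, rfl⟩

lemma en_eq (i : Fin m) (o : Bool) : ∃ j, en kind A ω i o = ω i j := by
  unfold en; split_ifs <;> exact ⟨_, rfl⟩

lemma en_ne {i : Fin m} (hinj : Function.Injective (ω i)) (o : Bool) :
    en kind A ω i o ≠ en kind A ω i (!o) := by
  have := sidx_ne (HH kind A ω) (ω i)
  cases o <;> simp only [en] <;> intro h
  · exact this (hinj (by simpa using h))
  · exact this (hinj (by simpa using h.symm))

lemma no_assign (hk : ∀ i, kind i ≠ 0 → 2 ≤ kind i) (hb : BadE kind ω) :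
    ¬ ∃ τ : {p // Pint kind ω p} → Bool, ∀ v w d, ImpR kind ω (v, τ v) (w, d) → τ w = d := by
  classical
  rintro ⟨τ, hτ⟩
  apply hb.2
  refine ⟨fun v => decide (v ∉ PP kind ∅ ω ∨ ∃ p, v = rt ω p.1 (τ p)), ?_, ?_⟩
  · intro i hi
    by_contra hcon
    push Not at hcon
    have key : ∀ o, ∃ p, en kind ∅ ω i o = rt ω p.1 (τ p) := by
      intro o
      obtain ⟨j, hj⟩ := en_eq kind ∅ ω i o
      have h1 := hcon j
      rw [← hj] at h1
      simp only [ne_eq, decide_eq_false_iff_not, not_not] at h1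
      rcases h1 with h1 | h1
      · exact absurd (en_mem kind ∅ ω hi o) h1
      · exact h1
    obtain ⟨p, hp⟩ := key true
    obtain ⟨p', hp'⟩ := key false
    have h2 := hτ p p' (!τ p') ⟨i, true, hi, hp.symm, by simp only [lf_not]; exact hp'.symm⟩
    simp at h2
  · intro p hp
    by_cases hP : Pint kind ω p
    · have h2 := hk p hp
      refine ⟨if τ ⟨p, hP⟩ then 1 else 0, ?_, ?_⟩
      · split_ifs <;> simp <;> omega
      · simp only [decide_eq_true_eq]
        right; exact ⟨⟨p, hP⟩, rfl⟩
    · unfold Pint at hP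
      push Not at hP
      obtain ⟨j, hj, hj2⟩ := hP (hk p hp)
      exact ⟨j, hj, by simp only [decide_eq_true_eq]; left; exact hj2⟩

lemma PP_not_II {v : Fin n} (hv : v ∈ PP kind A ω) : v ∉ II kind A ω := by
  simp only [PP, mem_filter, mem_univ, true_and] at hv
  obtain ⟨i, o, hi, rfl⟩ := hv
  have hS : ω i 0 ∈ SS kind ω := by
    simp only [SS, mem_filter, mem_univ, true_and]; exact ⟨i, hi, rfl⟩
  have hK : ω i 5 ∈ KK kind ω := by
    simp only [KK, mem_filter, mem_univ, true_and]; exact ⟨i, hi, rfl⟩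
  intro hI
  have hI' := hI
  simp only [II, mem_filter, mem_univ, true_and] at hI'
  cases o
  · simp only [en] at hI hI'
    rcases sidx_cases (HH kind A ω) (ω i) with h | ⟨h, -⟩
    · exact h (Finset.mem_union_right _ (by simpa using hI))
    · rw [h] at hI'; exact hI'.2.1 hK
  · simp only [en] at hI'; exact hI'.1 hS

lemma II_eq (hA : ∀ p ∈ A, Pint kind ω p) : II kind A ω = II kind ∅ ω := by
  have h2 : ∀ p ∈ A, ∀ j : Fin 6, j.1 < 2 → ω p j ∉ II kind ∅ ω := fun p hp j hj =>
    PP_not_II kind ∅ ω ((hA p hp).2 j (lt_of_lt_of_le hj (hA p hp).1))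
  ext v
  constructor
  · simp only [II, mem_filter, mem_univ, true_and]
    rintro ⟨h1, h3, p, -, h4⟩
    exact ⟨h1, h3, p, by simp, h4⟩
  · intro hv
    have hv' := hv
    simp only [II, mem_filter, mem_univ, true_and] at hv' ⊢
    obtain ⟨h1, h3, p, -, hp2, h4⟩ := hv'
    refine ⟨h1, h3, p, ?_, hp2, h4⟩
    intro hpA
    rcases h4 with ⟨h4, -⟩ | ⟨h4, -⟩
    · exact h2 p hpA 0 (by simp) (h4 ▸ hv)
    · exact h2 p hpA 1 (by simp) (h4 ▸ hv)

def bad (i : Fin m) : Prop := badx (HH kind A ω) (ω i)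

def Compat (κ : ℕ) (y y' : Fin m × Bool) : Prop :=
  κ = 2 → (y.2 = false → y'.2 = false → bad kind A ω y'.1) ∧
    (y.2 = true → y'.2 = true → bad kind A ω y.1)

lemma compat_of {p : Fin m} {d : Bool} (hp : Pint kind ω p) {y y' : Fin m × Bool}
    (hy : kind y.1 = 0) (hy' : kind y'.1 = 0)
    (h1 : lf ω p d = en kind ∅ ω y.1 (!y.2)) (h2 : rt ω p d = en kind ∅ ω y'.1 y'.2) :
    Compat kind ∅ ω (kind p) y y' := by
  intro hκ
  have gen : ∀ u w : Fin n, ∀ c, kind c = 0 → u ∈ SS kind ω → w = en kind ∅ ω c false →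
      ((ω p 0 = w ∧ ω p 1 = u) ∨ (ω p 1 = w ∧ ω p 0 = u)) → bad kind ∅ ω c := by
    intro u w c hc hu hw h
    have hwH : w ∈ HH kind ∅ ω := by
      by_contra hcon
      have hcon' := hcon
      simp only [HH, mem_union, not_or] at hcon
      apply hcon.2
      simp only [II, mem_filter, mem_univ, true_and]
      refine ⟨hcon.1.1, hcon.1.2, p, by simp, hκ, ?_⟩
      rcases h with ⟨h, h'⟩ | ⟨h, h'⟩
      · left; exact ⟨h, h' ▸ hu⟩
      · right; exact ⟨h, h' ▸ hu⟩
    rcases sidx_cases (HH kind ∅ ω) (ω c) with h' | ⟨-, h'⟩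
    · rw [hw] at hwH; exact absurd hwH h'
    · exact h'
  have hS : ∀ c, kind c = 0 → en kind ∅ ω c true ∈ SS kind ω := by
    intro c hc
    simp only [SS, mem_filter, mem_univ, true_and]; exact ⟨c, hc, rfl⟩
  constructor
  · intro ho ho'
    rw [ho] at h1; rw [ho'] at h2
    refine gen _ _ y'.1 hy' (hS y.1 hy) rfl ?_
    rw [← h2]; simp only [Bool.not_false] at h1; rw [← h1]
    cases d <;> simp [rt, lf]
  · intro ho ho'
    rw [ho] at h1; rw [ho'] at h2
    refine gen _ _ y.1 hy (hS y'.1 hy') rfl ?_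
    rw [← h2]; simp only [Bool.not_true] at h1; rw [← h1]
    cases d <;> simp [rt, lf]

def share (c c' : Fin m) : Prop := ∃ j j', ω c j = ω c' j'

open Classical in
noncomputable def N2 {t : ℕ} (y : Fin (t + 1) → Fin m × Bool) : Finset (Fin n) :=
  univ.filter fun v => ∃ i c c', kind c = 0 ∧ kind c' = 0 ∧ share ω (y i).1 c ∧ share ω c c' ∧
    ∃ j, ω c' j = v

structure Cert {t : ℕ} (p : Fin t ⊕ Bool → Fin m) (d : Fin t ⊕ Bool → Bool)
    (y : Fin (t + 1) → Fin m × Bool) : Prop where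
  neg : ∀ i, kind (y i).1 = 0
  intl : ∀ i : Fin t, lf ω (p (Sum.inl i)) (d (Sum.inl i)) =
    en kind A ω (y i.castSucc).1 (!(y i.castSucc).2)
  intr : ∀ i : Fin t, rt ω (p (Sum.inl i)) (d (Sum.inl i)) = en kind A ω (y i.succ).1 (y i.succ).2
  inte : ∀ i : Fin t, ∀ j : Fin 6, 2 ≤ j.1 → j.1 < kind (p (Sum.inl i)) →
    ω (p (Sum.inl i)) j ∈ PP kind A ω
  el1 : rt ω (p (Sum.inr false)) (d (Sum.inr false)) = en kind A ω (y 0).1 (y 0).2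
  el2 : lf ω (p (Sum.inr false)) (d (Sum.inr false)) ∈ N2 kind ω y
  er1 : lf ω (p (Sum.inr true)) (d (Sum.inr true)) =
    en kind A ω (y (Fin.last t)).1 (!(y (Fin.last t)).2)
  er2 : rt ω (p (Sum.inr true)) (d (Sum.inr true)) ∈ N2 kind ω y
  comp : ∀ i : Fin t, Compat kind A ω (kind (p (Sum.inl i))) (y i.castSucc) (y i.succ)

theorem exists_cert (hk : ∀ i, kind i ≠ 0 → 2 ≤ kind i) (hb : BadE kind ω) :
    ∃ (t : ℕ) (p : Fin t ⊕ Bool → Fin m) (d : Fin t ⊕ Bool → Bool), Function.Injective p ∧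
      (∀ a, 2 ≤ kind (p a)) ∧ HH kind (univ.image p) ω = HH kind ∅ ω ∧
      ∃ y, Cert kind (univ.image p) ω p d y := by
  classical
  obtain ⟨z, s, L, hs1, hsL, hw, hzs, hdist, jj, hj1, hjL, hjz⟩ :=
    twoSat_cert (ImpR kind ω) (ImpR_skew kind ω) (no_assign kind ω hk hb)
  have hw' : ∀ i, ∃ c o, i < L → (kind c = 0 ∧ rt ω (z i).1.1 (z i).2 = en kind ∅ ω c o ∧
      lf ω (z (i+1)).1.1 (z (i+1)).2 = en kind ∅ ω c (!o)) := by
    intro i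
    by_cases h : i < L
    · obtain ⟨c, o, h1⟩ := hw i h; exact ⟨c, o, fun _ => h1⟩
    · obtain ⟨c, o, h1⟩ := hw 0 (by omega); exact ⟨c, o, fun h' => absurd h' h⟩
  choose c o hco using hw'
  have hz0 : rt ω (z 0).1.1 (z 0).2 = lf ω (z s).1.1 (z s).2 := by
    rw [hzs]; simp only [ng]; rw [lf_not]
  have hs2 : 2 ≤ s := by
    by_contra h
    have hs : s = 1 := by omega
    subst hs
    obtain ⟨-, h1, h2⟩ := hco 0 (by omega)
    rw [hz0] at h1
    exact en_ne kind ∅ ω (hb.1 (c 0)) (o 0) (h1.symm.trans h2)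
  obtain ⟨t, rfl⟩ : ∃ t, L = t + 3 := ⟨L - 3, by omega⟩
  let ix : Fin t ⊕ Bool → ℕ := fun a => match a with
    | Sum.inl i => i.1 + 2
    | Sum.inr false => 1
    | Sum.inr true => t + 2
  have ix1 : ∀ a, 1 ≤ ix a ∧ ix a < t + 3 := by
    rintro (i | _ | _)
    · have := i.2; simp only [ix]; omega
    · simp only [ix]; omega
    · simp only [ix]; omega
  have ixinj : Function.Injective ix := by
    rintro (i | _ | _) (i' | _ | _) h <;> simp only [ix] at h <;>
      first | rfl | (exfalso; omega) | skip
    · congr 1; ext; omega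
  have hpinj : Function.Injective (fun a => (z (ix a)).1.1) := by
    intro a a' h
    have h' : (z (ix a)).1 = (z (ix a')).1 := Subtype.ext h
    apply ixinj
    rcases lt_trichotomy (ix a) (ix a') with h1 | h1 | h1
    · exact absurd h' (hdist _ _ (ix1 a).1 h1 (ix1 a').2)
    · exact h1
    · exact absurd h'.symm (hdist _ _ (ix1 a').1 h1 (ix1 a).2)
  have hPint : ∀ q ∈ univ.image (fun a => (z (ix a)).1.1), Pint kind ω q := by
    intro q hq
    simp only [mem_image, mem_univ, true_and] at hq
    obtain ⟨a, rfl⟩ := hq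
    exact (z (ix a)).1.2
  have hHH : HH kind (univ.image (fun a => (z (ix a)).1.1)) ω = HH kind ∅ ω := by
    unfold HH; rw [II_eq kind _ ω hPint]
  refine ⟨t, fun a => (z (ix a)).1.1, fun a => (z (ix a)).2, hpinj,
    fun a => (z (ix a)).1.2.1, hHH, fun i => (c (i.1 + 1), o (i.1 + 1)), ?_⟩
  generalize univ.image (fun a => (z (ix a)).1.1) = A at hHH
  have hen : ∀ i o, en kind A ω i o = en kind ∅ ω i o := by
    intro i o; unfold en; rw [hHH]
  have hPP : PP kind A ω = PP kind ∅ ω := by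
    unfold PP; simp only [hen]
  -- the first block shares a variable with the chain
  have hc0 : ∃ i : Fin (t + 1), share ω (c (i.1 + 1)) (c 0) := by
    refine ⟨⟨s - 2, by omega⟩, ?_⟩
    obtain ⟨-, h1, -⟩ := hco 0 (by omega)
    obtain ⟨-, -, h2⟩ := hco (s - 1) (by omega)
    rw [show s - 1 + 1 = s by omega] at h2
    rw [hz0, h2] at h1
    obtain ⟨j, hj⟩ := en_eq kind ∅ ω (c (s - 1)) (!(o (s - 1)))
    obtain ⟨j', hj'⟩ := en_eq kind ∅ ω (c 0) (o 0)
    refine ⟨j, j', ?_⟩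
    simp only
    rw [show s - 2 + 1 = s - 1 by omega, ← hj, ← hj', h1]
  have hrefl : ∀ c, share ω c c := fun c => ⟨0, 0, rfl⟩
  have hce : ∀ a b i o, en kind ∅ ω a i = en kind ∅ ω b o → share ω a b := by
    intro a b i o h
    obtain ⟨j, hj⟩ := en_eq kind ∅ ω a i
    obtain ⟨j', hj'⟩ := en_eq kind ∅ ω b o
    exact ⟨j, j', by rw [← hj, ← hj', h]⟩
  refine ⟨fun i => (hco (i.1 + 1) (by have := i.2; omega)).1, ?_, ?_, ?_, ?_, ?_, ?_, ?_, ?_⟩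
  · intro i; rw [hen]; exact (hco (i.1 + 1) (by have := i.2; omega)).2.2
  · intro i; rw [hen]; exact (hco (i.1 + 2) (by have := i.2; omega)).2.1
  · intro i j hj hj2
    rw [hPP]; exact (z (ix (Sum.inl i))).1.2.2 j hj2
  · rw [hen]; exact (hco 1 (by omega)).2.1
  · obtain ⟨i, hi⟩ := hc0
    obtain ⟨h0, -, h1⟩ := hco 0 (by omega)
    obtain ⟨j, hj⟩ := en_eq kind ∅ ω (c 0) (!(o 0))
    simp only [N2, mem_filter, mem_univ, true_and]
    exact ⟨i, c 0, c 0, h0, h0, hi, hrefl _, j, by rw [← hj, ← h1]⟩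
  · rw [hen]; exact (hco (t + 1) (by omega)).2.2
  · obtain ⟨h0, h1, h2⟩ := hco (t + 2) (by omega)
    obtain ⟨j, hj⟩ := en_eq kind ∅ ω (c (t + 2)) (o (t + 2))
    -- it suffices to connect the last block
    have hN : (∃ i : Fin (t + 1), ∃ c', kind c' = 0 ∧ share ω (c (i.1 + 1)) c' ∧
        share ω c' (c (t + 2))) := by
      have hin : ∀ i : ℕ, 1 ≤ i → i ≤ t + 1 → ∀ b b',
          en kind ∅ ω (c i) b = en kind ∅ ω (c (t + 2)) b' →
          (∃ i : Fin (t + 1), ∃ c', kind c' = 0 ∧ share ω (c (i.1 + 1)) c' ∧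
            share ω c' (c (t + 2))) := by
        intro i hi hi2 b b' h
        refine ⟨⟨i - 1, by omega⟩, c i, (hco i (by omega)).1, ?_, hce _ _ _ _ h⟩
        simp only
        rw [show i - 1 + 1 = i by omega]; exact hrefl _
      rcases eq_or_ng hjz.symm with h | h
      · rw [h] at h2
        by_cases hjj : jj = 1
        · subst hjj
          obtain ⟨i, hi⟩ := hc0
          refine ⟨i, c 0, (hco 0 (by omega)).1, hi, ?_⟩
          exact hce _ _ _ _ ((hco 0 (by omega)).2.2.symm.trans h2)
        · obtain ⟨j', rfl⟩ : ∃ j', jj = j' + 1 := ⟨jj - 1, by omega⟩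
          exact hin j' (by omega) (by omega) _ _ ((hco j' (by omega)).2.2.symm.trans h2)
      · rw [h] at h2
        simp only [ng] at h2
        rw [lf_not] at h2
        by_cases hjj : jj = t + 2
        · subst hjj
          exact absurd (h1.symm.trans h2) (en_ne kind ∅ ω (hb.1 _) _)
        · exact hin jj hj1 (by omega) _ _ ((hco jj (by omega)).2.1.symm.trans h2)
    obtain ⟨i, c', hc', hs1, hs2⟩ := hN
    simp only [N2, mem_filter, mem_univ, true_and]
    exact ⟨i, c', c (t + 2), hc', h0, hs1, hs2, j, by rw [← hj]; exact h1.symm⟩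
  · intro i
    have := compat_of kind ω (z (i.1 + 2)).1.2 (d := (z (i.1 + 2)).2)
      (y := (c (i.1 + 1), o (i.1 + 1))) (y' := (c (i.1 + 2), o (i.1 + 2)))
      (hco (i.1 + 1) (by have := i.2; omega)).1 (hco (i.1 + 2) (by have := i.2; omega)).1
      (hco (i.1 + 1) (by have := i.2; omega)).2.2 (hco (i.1 + 2) (by have := i.2; omega)).2.1
    unfold Compat bad at this ⊢
    rw [hHH]; exact this

end Core

end KS

/-! ### Chain sums -/

namespace KS

lemma sum_cons {X : Type*} [Fintype X] {t : ℕ} (F : (Fin (t + 1) → X) → ℝ) :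
    ∑ f, F f = ∑ x, ∑ f : Fin t → X, F (Fin.cons x f) := by
  rw [← Fintype.sum_prod_type' (f := fun x (f : Fin t → X) => F (Fin.cons x f))]
  exact (Fintype.sum_equiv (Fin.consEquiv (fun _ : Fin (t + 1) => X)) _ _ (fun x => rfl)).symm

noncomputable def stepW (ν μ : ℝ) (κ : ℕ) (w : ℝ × ℝ × ℝ) : ℝ × ℝ × ℝ :=
  if κ = 2 then (μ * w.1 + ν * w.2.1 + μ * w.2.2, ν * w.1, ν * w.2.1 + μ * w.2.2)
  else (ν * w.1 + ν * w.2.1 + μ * w.2.2, ν * w.1 + ν * w.2.1 + μ * w.2.2, 0)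

noncomputable def W (ν μ : ℝ) : (t : ℕ) → (Fin t → ℕ) → ℝ × ℝ × ℝ
  | 0, _ => (1, 1, 0)
  | t + 1, κ => stepW ν μ (κ 0) (W ν μ t (Fin.tail κ))

def Cp {m : ℕ} (B : Fin m → Prop) (κ : ℕ) (y y' : Fin m × Bool) : Prop :=
  κ = 2 → (y.2 = false → y'.2 = false → B y'.1) ∧ (y.2 = true → y'.2 = true → B y.1)

section
variable {m : ℕ} (B : Fin m → Prop) (N : Fin m → Prop)

noncomputable def Gs (t : ℕ) (κ : Fin t → ℕ) (y : Fin m × Bool) : ℝ :=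
  ∑ ys : Fin t → Fin m × Bool, ∏ i : Fin t,
    ind (N (ys i).1 ∧ Cp B (κ i) (Fin.cons (α := fun _ => Fin m × Bool) y ys i.castSucc) (ys i))

noncomputable def val (w : ℝ × ℝ × ℝ) (y : Fin m × Bool) : ℝ :=
  if y.2 then w.2.1 + ind (B y.1) * w.2.2 else w.1

lemma W_nonneg {ν μ : ℝ} (hν : 0 ≤ ν) (hμ : 0 ≤ μ) (t : ℕ) (κ : Fin t → ℕ) :
    0 ≤ (W ν μ t κ).1 ∧ 0 ≤ (W ν μ t κ).2.1 ∧ 0 ≤ (W ν μ t κ).2.2 := by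
  induction t with
  | zero => simp [W]
  | succ t ih =>
    obtain ⟨h1, h2, h3⟩ := ih (Fin.tail κ)
    simp only [W, stepW]
    split_ifs <;> simp only <;> refine ⟨?_, ?_, ?_⟩ <;> positivity

lemma Gs_succ (t : ℕ) (κ : Fin (t + 1) → ℕ) (y : Fin m × Bool) :
    Gs B N (t + 1) κ y = ∑ y', ind (N y'.1 ∧ Cp B (κ 0) y y') * Gs B N t (Fin.tail κ) y' := by
  unfold Gs
  rw [sum_cons]
  apply Finset.sum_congr rfl
  intro y' _
  rw [Finset.mul_sum]
  apply Finset.sum_congr rfl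
  intro ys _
  rw [Fin.prod_univ_succ]
  congr 1

lemma Gs_le {ν μ : ℝ} (hν : ∑ i, ind (N i) ≤ ν) (hμ : ∑ i, ind (N i ∧ B i) ≤ μ)
    (t : ℕ) (κ : Fin t → ℕ) (y : Fin m × Bool) :
    Gs B N t κ y ≤ val B (W ν μ t κ) y := by
  have hν0 : 0 ≤ ν := le_trans (Finset.sum_nonneg fun _ _ => ind_nonneg _) hν
  have hμ0 : 0 ≤ μ := le_trans (Finset.sum_nonneg fun _ _ => ind_nonneg _) hμ
  induction t generalizing y with
  | zero => simp [Gs, val, W]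
  | succ t ih =>
    rw [Gs_succ]
    obtain ⟨ha, hg, he⟩ := W_nonneg hν0 hμ0 t (Fin.tail κ)
    have h1 : ∑ y' : Fin m × Bool, ind (N y'.1 ∧ Cp B (κ 0) y y') * Gs B N t (Fin.tail κ) y' ≤
        ∑ y' : Fin m × Bool, ind (N y'.1 ∧ Cp B (κ 0) y y') * val B (W ν μ t (Fin.tail κ)) y' := by
      apply Finset.sum_le_sum; intro y' _
      exact mul_le_mul_of_nonneg_left (ih _ _) (ind_nonneg _)
    refine h1.trans ?_
    simp only [W]
    set w := W ν μ t (Fin.tail κ)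
    rw [Fintype.sum_prod_type]
    simp only [Fintype.sum_bool, val, if_true]
    have e1 : ∑ i, (ind (N i) * (w.2.1 + ind (B i) * w.2.2)) ≤ ν * w.2.1 + μ * w.2.2 := by
      have : ∀ i, ind (N i) * (w.2.1 + ind (B i) * w.2.2) =
          ind (N i) * w.2.1 + ind (N i ∧ B i) * w.2.2 := by
        intro i; rw [ind_and]; ring
      simp only [this]
      rw [Finset.sum_add_distrib, ← Finset.sum_mul, ← Finset.sum_mul]
      gcongr
    have e2 : ∑ i, ind (N i) * w.1 ≤ ν * w.1 := by
      rw [← Finset.sum_mul]; gcongr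
    have e3 : ∑ i, ind (N i ∧ B i) * w.1 ≤ μ * w.1 := by
      rw [← Finset.sum_mul]; gcongr
    have hv : ∀ i, 0 ≤ w.2.1 + ind (B i) * w.2.2 := fun i => by
      have := ind_nonneg (B i); positivity
    obtain ⟨c, o⟩ := y
    rw [Finset.sum_add_distrib]
    simp only [Bool.false_eq_true, if_false]
    by_cases hκ : κ 0 = 2
    · cases o
      · simp only [stepW, hκ, if_true, Bool.false_eq_true, if_false]
        have f1 : ∑ x, ind (N x ∧ Cp B 2 (c, false) (x, true)) * (w.2.1 + ind (B x) * w.2.2) ≤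
            ν * w.2.1 + μ * w.2.2 := by
          refine le_trans (Finset.sum_le_sum fun i _ => ?_) e1
          exact mul_le_mul_of_nonneg_right (ind_mono fun h => h.1) (hv i)
        have f2 : ∑ x, ind (N x ∧ Cp B 2 (c, false) (x, false)) * w.1 ≤ μ * w.1 := by
          refine le_trans (Finset.sum_le_sum fun i _ => ?_) e3
          exact mul_le_mul_of_nonneg_right
            (ind_mono fun h => ⟨h.1, (h.2 rfl).1 rfl rfl⟩) ha
        linarith
      · simp only [stepW, hκ, if_true]
        have f2 : ∑ x, ind (N x ∧ Cp B 2 (c, true) (x, false)) * w.1 ≤ ν * w.1 := by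
          refine le_trans (Finset.sum_le_sum fun i _ => ?_) e2
          exact mul_le_mul_of_nonneg_right (ind_mono fun h => h.1) ha
        have f1 : ∑ x, ind (N x ∧ Cp B 2 (c, true) (x, true)) * (w.2.1 + ind (B x) * w.2.2) ≤
            ind (B c) * (ν * w.2.1 + μ * w.2.2) := by
          by_cases hc : B c
          · rw [ind_true hc, one_mul]
            refine le_trans (Finset.sum_le_sum fun i _ => ?_) e1
            exact mul_le_mul_of_nonneg_right (ind_mono fun h => h.1) (hv i)
          · rw [ind_false hc, zero_mul]
            apply le_of_eq; apply Finset.sum_eq_zero; intro i _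
            rw [ind_false, zero_mul]
            intro h; exact hc ((h.2 rfl).2 rfl rfl)
        linarith
    · have f1 : ∀ o, ∑ x, ind (N x ∧ Cp B (κ 0) (c, o) (x, true)) *
          (w.2.1 + ind (B x) * w.2.2) ≤ ν * w.2.1 + μ * w.2.2 := by
        intro o
        refine le_trans (Finset.sum_le_sum fun i _ => ?_) e1
        exact mul_le_mul_of_nonneg_right (ind_mono fun h => h.1) (hv i)
      have f2 : ∀ o, ∑ x, ind (N x ∧ Cp B (κ 0) (c, o) (x, false)) * w.1 ≤ ν * w.1 := by
        intro o
        refine le_trans (Finset.sum_le_sum fun i _ => ?_) e2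
        exact mul_le_mul_of_nonneg_right (ind_mono fun h => h.1) ha
      have g1 := f1 o
      have g2 := f2 o
      simp only [stepW, hκ, if_false]
      split_ifs <;> linarith

/-- total number of compatible chains -/
lemma chain_total {ν μ : ℝ} (hν : ∑ i, ind (N i) ≤ ν) (hμ : ∑ i, ind (N i ∧ B i) ≤ μ)
    (t : ℕ) (κ : Fin t → ℕ) :
    ∑ y : Fin (t + 1) → Fin m × Bool,
      ind ((∀ i, N (y i).1) ∧ ∀ i : Fin t, Cp B (κ i) (y i.castSucc) (y i.succ)) ≤
      ν * (W ν μ t κ).1 + ν * (W ν μ t κ).2.1 + μ * (W ν μ t κ).2.2 := by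
  have hν0 : 0 ≤ ν := le_trans (Finset.sum_nonneg fun _ _ => ind_nonneg _) hν
  have hμ0 : 0 ≤ μ := le_trans (Finset.sum_nonneg fun _ _ => ind_nonneg _) hμ
  obtain ⟨ha, hg, he⟩ := W_nonneg hν0 hμ0 t κ
  rw [sum_cons]
  have h1 : ∀ y0 : Fin m × Bool, ∑ ys : Fin t → Fin m × Bool,
      ind ((∀ i, N ((Fin.cons y0 ys : Fin (t + 1) → Fin m × Bool) i).1) ∧
        ∀ i : Fin t, Cp B (κ i) ((Fin.cons y0 ys : Fin (t + 1) → Fin m × Bool) i.castSucc)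
          ((Fin.cons y0 ys : Fin (t + 1) → Fin m × Bool) i.succ)) ≤
      ind (N y0.1) * Gs B N t κ y0 := by
    intro y0
    unfold Gs
    rw [Finset.mul_sum]
    apply Finset.sum_le_sum
    intro ys _
    rw [← ind_forall, ← ind_and]
    apply ind_mono
    rintro ⟨h1, h2⟩
    refine ⟨by simpa using h1 0, fun i => ⟨by simpa using h1 i.succ, by simpa using h2 i⟩⟩
  refine (Finset.sum_le_sum fun y0 _ => h1 y0).trans ?_
  refine (Finset.sum_le_sum fun y0 _ => mul_le_mul_of_nonneg_left
    (Gs_le B N hν hμ t κ y0) (ind_nonneg _)).trans ?_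
  set w := W ν μ t κ
  rw [Fintype.sum_prod_type]
  simp only [Fintype.sum_bool, val, if_true, Bool.false_eq_true, if_false]
  have : ∀ i, ind (N i) * (w.2.1 + ind (B i) * w.2.2) + ind (N i) * w.1 =
      ind (N i) * w.1 + ind (N i) * w.2.1 + ind (N i ∧ B i) * w.2.2 := by
    intro i; rw [ind_and]; ring
  simp only [this]
  rw [Finset.sum_add_distrib, Finset.sum_add_distrib, ← Finset.sum_mul, ← Finset.sum_mul,
    ← Finset.sum_mul]
  gcongr

end

/-- weighted sum over the interior positive clauses -/
lemma weight_bound {m : ℕ} (kind : Fin m → ℕ) (w : Fin m → ℝ) (hw : ∀ i, 0 ≤ w i)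
    {ν μ s2 s3 hA hG hE lam : ℝ} (hν : 0 ≤ ν) (hμ : 0 ≤ μ) (hA1 : 1 ≤ hA) (hG1 : 1 ≤ hG)
    (hE0 : 0 ≤ hE) (hl : 0 ≤ lam)
    (h2 : ∑ i, ind (kind i = 2) * w i ≤ s2) (h3 : ∑ i, ind (kind i ≠ 2) * w i ≤ s3)
    (iA : s2 * (μ * hA + ν * hG + μ * hE) + s3 * (ν * hA + ν * hG + μ * hE) ≤ lam * hA)
    (iG : s2 * (ν * hA) + s3 * (ν * hA + ν * hG + μ * hE) ≤ lam * hG)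
    (iE : s2 * (ν * hG + μ * hE) ≤ lam * hE) (t : ℕ) :
    (∑ q : Fin t → Fin m, (∏ i, w (q i)) * (W ν μ t (fun i => kind (q i))).1 ≤ lam ^ t * hA) ∧
    (∑ q : Fin t → Fin m, (∏ i, w (q i)) * (W ν μ t (fun i => kind (q i))).2.1 ≤ lam ^ t * hG) ∧
    (∑ q : Fin t → Fin m, (∏ i, w (q i)) * (W ν μ t (fun i => kind (q i))).2.2 ≤ lam ^ t * hE) := by
  induction t with
  | zero => simp [W, hA1, hG1, hE0]
  | succ t ih =>
    obtain ⟨jA, jG, jE⟩ := ih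
    set a := ∑ q : Fin t → Fin m, (∏ i, w (q i)) * (W ν μ t (fun i => kind (q i))).1 with ea
    set g := ∑ q : Fin t → Fin m, (∏ i, w (q i)) * (W ν μ t (fun i => kind (q i))).2.1 with eg
    set e := ∑ q : Fin t → Fin m, (∏ i, w (q i)) * (W ν μ t (fun i => kind (q i))).2.2 with ee
    have hpr : ∀ q : Fin t → Fin m, 0 ≤ ∏ i, w (q i) := fun q => Finset.prod_nonneg fun i _ => hw _
    have ha0 : 0 ≤ a := Finset.sum_nonneg fun q _ => mul_nonneg (hpr q) (W_nonneg hν hμ t _).1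
    have hg0 : 0 ≤ g := Finset.sum_nonneg fun q _ => mul_nonneg (hpr q) (W_nonneg hν hμ t _).2.1
    have he0 : 0 ≤ e := Finset.sum_nonneg fun q _ => mul_nonneg (hpr q) (W_nonneg hν hμ t _).2.2
    have hs2 : 0 ≤ s2 := le_trans (Finset.sum_nonneg fun i _ => mul_nonneg (ind_nonneg _) (hw i)) h2
    have hs3 : 0 ≤ s3 := le_trans (Finset.sum_nonneg fun i _ => mul_nonneg (ind_nonneg _) (hw i)) h3
    have hlt : 0 ≤ lam ^ t := by positivity
    have lin : ∀ x y z : ℝ, ∑ q : Fin t → Fin m, (∏ i, w (q i)) *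
        (x * (W ν μ t (fun i => kind (q i))).1 + y * (W ν μ t (fun i => kind (q i))).2.1 +
          z * (W ν μ t (fun i => kind (q i))).2.2) = x * a + y * g + z * e := by
      intro x y z
      rw [ea, eg, ee, Finset.mul_sum, Finset.mul_sum, Finset.mul_sum, ← Finset.sum_add_distrib,
        ← Finset.sum_add_distrib]
      apply Finset.sum_congr rfl; intro q _; ring
    -- general linear functional
    have gen : ∀ (π : ℝ × ℝ × ℝ → ℝ) (x2 y2 z2 x3 y3 z3 : ℝ),
        (∀ κ v, π (stepW ν μ κ v) = if κ = 2 then x2 * v.1 + y2 * v.2.1 + z2 * v.2.2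
          else x3 * v.1 + y3 * v.2.1 + z3 * v.2.2) →
        0 ≤ x2 → 0 ≤ y2 → 0 ≤ z2 → 0 ≤ x3 → 0 ≤ y3 → 0 ≤ z3 →
        ∑ q : Fin (t + 1) → Fin m, (∏ i, w (q i)) * π (W ν μ (t + 1) (fun i => kind (q i))) ≤
          lam ^ t * (s2 * (x2 * hA + y2 * hG + z2 * hE) + s3 * (x3 * hA + y3 * hG + z3 * hE)) := by
      intro π x2 y2 z2 x3 y3 z3 hπ p1 p2 p3 p4 p5 p6
      rw [sum_cons]
      have e1 : ∀ x : Fin m, ∑ f : Fin t → Fin m,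
          (∏ i, w ((Fin.cons x f : Fin (t + 1) → Fin m) i)) *
            π (W ν μ (t + 1) (fun i => kind ((Fin.cons x f : Fin (t + 1) → Fin m) i))) =
          ind (kind x = 2) * w x * (x2 * a + y2 * g + z2 * e) +
          ind (kind x ≠ 2) * w x * (x3 * a + y3 * g + z3 * e) := by
        intro x
        have e2 : ∀ f : Fin t → Fin m, (∏ i, w ((Fin.cons x f : Fin (t + 1) → Fin m) i)) *
            π (W ν μ (t + 1) (fun i => kind ((Fin.cons x f : Fin (t + 1) → Fin m) i))) =
            w x * ((∏ i, w (f i)) * π (stepW ν μ (kind x) (W ν μ t (fun i => kind (f i))))) := by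
          intro f
          rw [Fin.prod_univ_succ, mul_assoc]; rfl
        simp only [e2, hπ]
        rw [← Finset.mul_sum]
        by_cases hx : kind x = 2
        · simp only [hx, if_true, ne_eq, not_true_eq_false]
          rw [ind_true trivial, ind_false not_false, lin]; ring
        · simp only [hx, if_false, ne_eq, not_false_eq_true]
          rw [ind_true trivial, ind_false not_false, lin]; ring
      simp only [e1]
      rw [Finset.sum_add_distrib, ← Finset.sum_mul, ← Finset.sum_mul]
      calc _ ≤ s2 * (x2 * a + y2 * g + z2 * e) + s3 * (x3 * a + y3 * g + z3 * e) := by gcongr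
        _ ≤ s2 * (x2 * (lam ^ t * hA) + y2 * (lam ^ t * hG) + z2 * (lam ^ t * hE)) +
            s3 * (x3 * (lam ^ t * hA) + y3 * (lam ^ t * hG) + z3 * (lam ^ t * hE)) := by gcongr
        _ = _ := by ring
    refine ⟨?_, ?_, ?_⟩
    · refine (gen (fun v => v.1) μ ν μ ν ν μ ?_ hμ hν hμ hν hν hμ).trans ?_
      · intro κ v; simp only [stepW]; split_ifs <;> rfl
      · rw [pow_succ, mul_assoc]; gcongr
    · refine (gen (fun v => v.2.1) ν 0 0 ν ν μ ?_ hν le_rfl le_rfl hν hν hμ).trans ?_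
      · intro κ v; simp only [stepW]; split_ifs
        · ring
        · rfl
      · rw [pow_succ, mul_assoc]
        apply mul_le_mul_of_nonneg_left _ hlt
        linarith
    · refine (gen (fun v => v.2.2) 0 ν μ 0 0 0 ?_ le_rfl hν hμ le_rfl le_rfl le_rfl).trans ?_
      · intro κ v; simp only [stepW]; split_ifs <;> ring
      · rw [pow_succ, mul_assoc]
        apply mul_le_mul_of_nonneg_left _ hlt
        linarith

end KS

/-! ### Probability of a given certificate -/

namespace KS

section Inv
variable {n m : ℕ} (kind : Fin m → ℕ) (A : Finset (Fin m)) {ω ω' : Fin m → Fin 6 → Fin n}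

lemma SS_inv (h : ∀ i, kind i = 0 → ω i 0 = ω' i 0) : SS kind ω = SS kind ω' := by
  unfold SS; ext v; simp only [mem_filter, mem_univ, true_and]
  constructor <;> rintro ⟨i, hi, h1⟩ <;> refine ⟨i, hi, ?_⟩
  · rw [← h i hi, h1]
  · rw [h i hi, h1]

lemma KK_inv (h : ∀ i, kind i = 0 → ω i 5 = ω' i 5) : KK kind ω = KK kind ω' := by
  unfold KK; ext v; simp only [mem_filter, mem_univ, true_and]
  constructor <;> rintro ⟨i, hi, h1⟩ <;> refine ⟨i, hi, ?_⟩
  · rw [← h i hi, h1]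
  · rw [h i hi, h1]

lemma HH_inv (h0 : ∀ i, kind i = 0 → ω i 0 = ω' i 0) (h5 : ∀ i, kind i = 0 → ω i 5 = ω' i 5)
    (h2 : ∀ i, i ∉ A → kind i = 2 → ω i 0 = ω' i 0 ∧ ω i 1 = ω' i 1) :
    HH kind A ω = HH kind A ω' := by
  have hS := SS_inv kind h0
  have hK := KK_inv kind h5
  unfold HH
  rw [hS, hK]
  congr 1
  unfold II
  rw [hS, hK]
  ext v; simp only [mem_filter, mem_univ, true_and]
  apply and_congr_right; intro _; apply and_congr_right; intro _
  apply exists_congr; intro p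
  apply and_congr_right; intro hp; apply and_congr_right; intro hp2
  obtain ⟨e0, e1⟩ := h2 p hp hp2
  rw [e0, e1]

variable (hA : ∀ i ∈ A, kind i ≠ 0) (hω : ∀ i, i ∉ A → ω i = ω' i)
include hA hω

lemma neg_inv {i : Fin m} (hi : kind i = 0) : ω i = ω' i := hω i fun h => hA i h hi

lemma HH_inv' : HH kind A ω = HH kind A ω' :=
  HH_inv kind A (fun i hi => by rw [neg_inv kind A hA hω hi])
    (fun i hi => by rw [neg_inv kind A hA hω hi]) (fun i hi _ => by rw [hω i hi]; simp)

lemma en_inv {i : Fin m} (hi : kind i = 0) (o : Bool) : en kind A ω i o = en kind A ω' i o := by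
  unfold en; rw [HH_inv' kind A hA hω, neg_inv kind A hA hω hi]

lemma bad_inv {i : Fin m} (hi : kind i = 0) : bad kind A ω i ↔ bad kind A ω' i := by
  unfold bad; rw [HH_inv' kind A hA hω, neg_inv kind A hA hω hi]

lemma PP_inv : PP kind A ω = PP kind A ω' := by
  unfold PP; ext v; simp only [mem_filter, mem_univ, true_and]
  constructor <;> rintro ⟨i, o, hi, h1⟩ <;> refine ⟨i, o, hi, ?_⟩
  · rw [← en_inv kind A hA hω hi, h1]
  · rw [en_inv kind A hA hω hi, h1]

lemma N2_inv {t : ℕ} (y : Fin (t + 1) → Fin m × Bool) (hy : ∀ i, kind (y i).1 = 0) :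
    N2 kind ω y = N2 kind ω' y := by
  unfold N2 share; ext v; simp only [mem_filter, mem_univ, true_and]
  apply exists_congr; intro i; apply exists_congr; intro c; apply exists_congr; intro c'
  apply and_congr_right; intro hc; apply and_congr_right; intro hc'
  rw [neg_inv kind A hA hω (hy i), neg_inv kind A hA hω hc, neg_inv kind A hA hω hc']

end Inv

section
variable {n m : ℕ} (kind : Fin m → ℕ)

open Classical in
def E1 (D : ℕ) (ω : Fin m → Fin 6 → Fin n) : Prop :=
  ∀ v, (univ.filter fun c => kind c = 0 ∧ ∃ j, ω c j = v).card ≤ D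

lemma E1_inv (A : Finset (Fin m)) {ω ω' : Fin m → Fin 6 → Fin n} (hA : ∀ i ∈ A, kind i ≠ 0)
    (hω : ∀ i, i ∉ A → ω i = ω' i) (D : ℕ) (h : E1 kind D ω) : E1 kind D ω' := by
  classical
  intro v
  refine le_trans (le_of_eq ?_) (h v)
  congr 1; ext c; simp only [mem_filter, mem_univ, true_and]
  apply and_congr_right; intro hc
  rw [neg_inv kind A hA hω hc]

lemma N2_card {D t : ℕ} {ω : Fin m → Fin 6 → Fin n} (h : E1 kind D ω)
    (y : Fin (t + 1) → Fin m × Bool) : (N2 kind ω y).card ≤ 216 * D ^ 2 * (t + 1) := by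
  classical
  let nb : Fin n → Finset (Fin m) := fun v => univ.filter fun c => kind c = 0 ∧ ∃ j, ω c j = v
  have hnb : ∀ v, (nb v).card ≤ D := h
  let T : Finset (Fin n) := (univ : Finset (Fin (t + 1))).biUnion fun i =>
    (univ : Finset (Fin 6)).biUnion fun j => (nb (ω (y i).1 j)).biUnion fun c =>
    (univ : Finset (Fin 6)).biUnion fun j' => (nb (ω c j')).biUnion fun c' =>
    (univ : Finset (Fin 6)).image fun j'' => ω c' j''
  have hsub : N2 kind ω y ⊆ T := by
    intro v hv
    simp only [N2, mem_filter, mem_univ, true_and] at hv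
    obtain ⟨i, c, c', hc, hc', ⟨j1, j2, e1⟩, ⟨j3, j4, e2⟩, j5, e3⟩ := hv
    simp only [T, nb, mem_biUnion, mem_filter, mem_univ, true_and, mem_image]
    exact ⟨i, j1, c, ⟨hc, j2, e1.symm⟩, j3, c', ⟨hc', j4, e2.symm⟩, j5, e3⟩
  have h6 : ∀ c' : Fin m, ((univ : Finset (Fin 6)).image fun j'' => ω c' j'').card ≤ 6 :=
    fun c' => card_image_le.trans (by simp)
  have b : ∀ {α : Type} (s : Finset α) (f : α → Finset (Fin n)) (k K : ℕ), s.card ≤ K →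
      (∀ a ∈ s, (f a).card ≤ k) → (s.biUnion f).card ≤ K * k := by
    intro α s f k K hs hf
    exact (card_biUnion_le_card_mul s f k hf).trans (Nat.mul_le_mul_right _ hs)
  calc (N2 kind ω y).card ≤ T.card := card_le_card hsub
    _ ≤ (t + 1) * (6 * (D * (6 * (D * 6)))) := by
        refine b _ _ _ _ (by simp) fun i _ => ?_
        refine b _ _ _ _ (by simp) fun j _ => ?_
        refine b _ _ _ _ (hnb _) fun c _ => ?_
        refine b _ _ _ _ (by simp) fun j _ => ?_
        refine b _ _ _ _ (hnb _) fun c' _ => h6 c'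
    _ = _ := by ring

lemma PP_card (A : Finset (Fin m)) (ω : Fin m → Fin 6 → Fin n) {ν : ℝ}
    (hν : ∑ i, ind (kind i = 0) ≤ ν) : ((PP kind A ω).card : ℝ) ≤ 2 * ν := by
  classical
  have h1 : PP kind A ω ⊆ ((univ.filter fun i => kind i = 0) ×ˢ (univ : Finset Bool)).image
      fun x => en kind A ω x.1 x.2 := by
    intro v hv
    simp only [PP, mem_filter, mem_univ, true_and] at hv
    obtain ⟨i, o, hi, h⟩ := hv
    simp only [mem_image, mem_product, mem_filter, mem_univ, true_and, and_true]
    exact ⟨(i, o), hi, h⟩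
  have h2 : (PP kind A ω).card ≤ (univ.filter fun i => kind i = 0).card * 2 := by
    refine (card_le_card h1).trans (card_image_le.trans ?_)
    rw [card_product]; simp
  have h3 : ((univ.filter fun i => kind i = 0).card : ℝ) = ∑ i, ind (kind i = 0) := by
    rw [Finset.card_filter]; push_cast
    apply Finset.sum_congr rfl; intro i _; unfold ind; split_ifs <;> rfl
  have h4 : ((PP kind A ω).card : ℝ) ≤ ((univ.filter fun i => kind i = 0).card : ℝ) * 2 := by
    exact_mod_cast h2
  linarith

lemma powx (x : ℝ) (κ : ℕ) (hκ : 2 ≤ κ) (hκ4 : κ ≤ 4) :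
    (if 2 < κ then x else 1) * (if 3 < κ then x else 1) = x ^ (κ - 2) := by
  have : κ = 2 ∨ κ = 3 ∨ κ = 4 := by omega
  rcases this with h | h | h <;> subst h <;> norm_num [pow_two]

lemma mul3 {a b c A B : ℝ} (ha : a ≤ A) (hb : b ≤ B) (hc : c ≤ B) (h0 : 0 ≤ a) (h1 : 0 ≤ b)
    (h2 : 0 ≤ c) : a * (b * c) ≤ A * B ^ 2 := by
  rw [sq]
  exact mul_le_mul ha (mul_le_mul hb hc h2 (h1.trans hb)) (mul_nonneg h1 h2) (h0.trans ha)

lemma prC (hn : 0 < n) (C : Fin 6 → Finset (Fin n)) (x2 x3 : ℝ)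
    (h2 : ((C 2).card : ℝ) ≤ x2 * n) (h3 : ((C 3).card : ℝ) ≤ x3 * n) :
    pr (fun z : Fin 6 → Fin n => ∀ j, z j ∈ C j) ≤
      (C 0).card * (C 1).card * (1 / (n : ℝ) ^ 2 * (x2 * x3)) := by
  have hn' : (0 : ℝ) < n := by exact_mod_cast hn
  rw [pr_pi (fun j (v : Fin n) => v ∈ C j)]
  simp only [pr_mem, Fintype.card_fin]
  rw [Fin.prod_univ_six]
  have h1 : ∀ j, ((C j).card : ℝ) / n ≤ 1 := fun j => by
    rw [div_le_one hn']
    have := card_le_univ (C j)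
    rw [Fintype.card_fin] at this
    exact_mod_cast this
  have hp : ∀ j, 0 ≤ ((C j).card : ℝ) / n := fun j => by positivity
  rw [← div_le_iff₀ hn'] at h2 h3
  have k1 := mul_le_mul h2 h3 (hp 3) ((hp 2).trans h2)
  have k2 := mul_le_one₀ (h1 4) (hp 5) (h1 5)
  have k3 := mul_le_mul k1 k2 (mul_nonneg (hp 4) (hp 5)) (le_trans (mul_nonneg (hp 2) (hp 3)) k1)
  have k4 := mul_le_mul_of_nonneg_left k3 (mul_nonneg (hp 0) (hp 1))
  refine le_trans (le_of_eq (by ring)) (k4.trans (le_of_eq ?_))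
  field_simp

lemma prQ0 (hn : 0 < n) (U V P : Finset (Fin n)) (κ : ℕ) (hκ : 2 ≤ κ) (hκ4 : κ ≤ 4)
    (x : ℝ) (hP : (P.card : ℝ) ≤ x * n) :
    pr (fun z : Fin 6 → Fin n => z 0 ∈ U ∧ z 1 ∈ V ∧
      ∀ j : Fin 6, 2 ≤ j.1 → j.1 < κ → z j ∈ P) ≤
    U.card * V.card * (1 / (n : ℝ) ^ 2 * x ^ (κ - 2)) := by
  classical
  let C : Fin 6 → Finset (Fin n) := ![U, V, if 2 < κ then P else univ, if 3 < κ then P else univ,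
    univ, univ]
  have h1 : ∀ z : Fin 6 → Fin n, (z 0 ∈ U ∧ z 1 ∈ V ∧
      ∀ j : Fin 6, 2 ≤ j.1 → j.1 < κ → z j ∈ P) → ∀ j, z j ∈ C j := by
    rintro z ⟨h1, h2, h3⟩ j
    fin_cases j
    · exact h1
    · exact h2
    · change z 2 ∈ (if 2 < κ then P else univ)
      split_ifs with h
      · exact h3 2 le_rfl h
      · exact mem_univ _
    · change z 3 ∈ (if 3 < κ then P else univ)
      split_ifs with h
      · exact h3 3 (Nat.le_succ 2) h
      · exact mem_univ _
    · exact mem_univ _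
    · exact mem_univ _
  have hu : ((univ : Finset (Fin n)).card : ℝ) ≤ 1 * n := by simp
  have hc2 : ((C 2).card : ℝ) ≤ (if 2 < κ then x else 1) * n := by
    change (((if 2 < κ then P else univ) : Finset (Fin n)).card : ℝ) ≤ _
    split_ifs
    · exact hP
    · exact hu
  have hc3 : ((C 3).card : ℝ) ≤ (if 3 < κ then x else 1) * n := by
    change (((if 3 < κ then P else univ) : Finset (Fin n)).card : ℝ) ≤ _
    split_ifs
    · exact hP
    · exact hu
  have h4 := prC hn C _ _ hc2 hc3
  rw [powx x κ hκ hκ4] at h4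
  exact (pr_mono h1).trans h4

lemma prQ (hn : 0 < n) (d : Bool) (U V P : Finset (Fin n)) (κ : ℕ) (hκ : 2 ≤ κ) (hκ4 : κ ≤ 4)
    (x : ℝ) (hP : (P.card : ℝ) ≤ x * n) :
    pr (fun z : Fin 6 → Fin n => z (if d then 0 else 1) ∈ U ∧ z (if d then 1 else 0) ∈ V ∧
      ∀ j : Fin 6, 2 ≤ j.1 → j.1 < κ → z j ∈ P) ≤
    U.card * V.card * (1 / (n : ℝ) ^ 2 * x ^ (κ - 2)) := by
  cases d
  · have h := prQ0 hn V U P κ hκ hκ4 x hP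
    rw [mul_comm (V.card : ℝ)] at h
    refine le_trans (pr_mono ?_) h
    rintro z ⟨h1, h2, h3⟩
    exact ⟨h2, h1, h3⟩
  · exact prQ0 hn U V P κ hκ hκ4 x hP

set_option maxHeartbeats 1000000 in
theorem cert_pr (hn : 0 < n) {t : ℕ} (p : Fin t ⊕ Bool → Fin m) (d : Fin t ⊕ Bool → Bool)
    (hp : Function.Injective p) (hk : ∀ a, 2 ≤ kind (p a) ∧ kind (p a) ≤ 4) {ν μ x : ℝ} (D : ℕ)
    (hν : ∑ i, ind (kind i = 0) ≤ ν) (hμ0 : 0 ≤ μ) (hx : 2 * ν ≤ x * n) :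
    pr (fun ω : Fin m → Fin 6 → Fin n => E1 kind D ω ∧
      ∑ i, ind (kind i = 0 ∧ bad kind (univ.image p) ω i) ≤ μ ∧
      ∃ y, Cert kind (univ.image p) ω p d y) ≤
    (∏ i : Fin t, (1 / (n : ℝ) ^ 2 * x ^ (kind (p (Sum.inl i)) - 2))) *
      (216 * D ^ 2 * (t + 1) / (n : ℝ) ^ 2) ^ 2 *
      (ν * (W ν μ t (fun i => kind (p (Sum.inl i)))).1 +
        ν * (W ν μ t (fun i => kind (p (Sum.inl i)))).2.1 +
        μ * (W ν μ t (fun i => kind (p (Sum.inl i)))).2.2) := by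
  classical
  have : Nonempty (Fin n) := ⟨⟨0, hn⟩⟩
  have hn' : (0 : ℝ) < n := by exact_mod_cast hn
  have hν0 : 0 ≤ ν := le_trans (Finset.sum_nonneg fun _ _ => ind_nonneg _) hν
  have hx0 : 0 ≤ x := by
    by_contra h
    push Not at h
    have : x * n < 0 := mul_neg_of_neg_of_pos h hn'
    linarith
  set A : Finset (Fin m) := univ.image p with hAdef
  have hA : ∀ i ∈ A, kind i ≠ 0 := by
    intro i hi
    simp only [hAdef, mem_image, mem_univ, true_and] at hi
    obtain ⟨a, rfl⟩ := hi
    have := hk a; omega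
  let mix : (Fin m → Fin 6 → Fin n) → (Fin m → Fin 6 → Fin n) → (Fin m → Fin 6 → Fin n) :=
    fun a b i => if i ∈ A then b i else a i
  have hmix : ∀ a b, mix (mix a b) (mix b a) = a := by
    intro a b; funext i; simp only [mix]; split_ifs <;> rfl
  unfold pr
  rw [Ex_mix mix hmix]
  apply Ex_le_const
  intro a
  have hag : ∀ b, ∀ i, i ∉ A → mix a b i = a i := by
    intro b i hi; simp [mix, hi]
  have hmA : ∀ b s, mix a b (p s) = b (p s) := by
    intro b s
    have : p s ∈ A := by simp [hAdef]
    simp [mix, this]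
  have hbound0 : 0 ≤ (∏ i : Fin t, (1 / (n : ℝ) ^ 2 * x ^ (kind (p (Sum.inl i)) - 2))) *
      (216 * D ^ 2 * (t + 1) / (n : ℝ) ^ 2) ^ 2 *
      (ν * (W ν μ t (fun i => kind (p (Sum.inl i)))).1 +
        ν * (W ν μ t (fun i => kind (p (Sum.inl i)))).2.1 +
        μ * (W ν μ t (fun i => kind (p (Sum.inl i)))).2.2) := by
    obtain ⟨h1, h2, h3⟩ := W_nonneg hν0 hμ0 t (fun i => kind (p (Sum.inl i)))
    positivity
  have badeq : ∀ b, ∑ i, ind (kind i = 0 ∧ bad kind A (mix a b) i) =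
      ∑ i, ind (kind i = 0 ∧ bad kind A a i) := by
    intro b; apply Finset.sum_congr rfl; intro i _; congr 1; apply propext
    apply and_congr_right; intro hi; exact bad_inv kind A hA (hag b) hi
  by_cases hE : E1 kind D a ∧ ∑ i, ind (kind i = 0 ∧ bad kind A a i) ≤ μ
  swap
  · refine le_trans (le_of_eq ?_) hbound0
    have : ∀ b, ind (E1 kind D (mix a b) ∧ ∑ i, ind (kind i = 0 ∧ bad kind A (mix a b) i) ≤ μ ∧
      ∃ y, Cert kind A (mix a b) p d y) = 0 := by
      intro b
      apply ind_false
      rintro ⟨h1, h2, -⟩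
      apply hE
      exact ⟨E1_inv kind A hA (hag b) D h1, by rw [← badeq b]; exact h2⟩
    simp only [this]
    exact Ex_const 0
  obtain ⟨hE1, hE3⟩ := hE
  let U : (Fin (t + 1) → Fin m × Bool) → Fin t ⊕ Bool → Finset (Fin n) := fun y s => match s with
    | Sum.inl i => {en kind A a (y i.castSucc).1 (!(y i.castSucc).2)}
    | Sum.inr false => N2 kind a y
    | Sum.inr true => {en kind A a (y (Fin.last t)).1 (!(y (Fin.last t)).2)}
  let V : (Fin (t + 1) → Fin m × Bool) → Fin t ⊕ Bool → Finset (Fin n) := fun y s => match s with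
    | Sum.inl i => {en kind A a (y i.succ).1 (y i.succ).2}
    | Sum.inr false => {en kind A a (y 0).1 (y 0).2}
    | Sum.inr true => N2 kind a y
  let κ : Fin t ⊕ Bool → ℕ := fun s => match s with
    | Sum.inl i => kind (p (Sum.inl i))
    | Sum.inr _ => 2
  let Q : (Fin (t + 1) → Fin m × Bool) → Fin t ⊕ Bool → (Fin 6 → Fin n) → Prop := fun y s z =>
    z (if d s then 0 else 1) ∈ U y s ∧ z (if d s then 1 else 0) ∈ V y s ∧
      ∀ j : Fin 6, 2 ≤ j.1 → j.1 < κ s → z j ∈ PP kind A a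
  let R : (Fin (t + 1) → Fin m × Bool) → Prop := fun y => (∀ i, kind (y i).1 = 0) ∧
    ∀ i : Fin t, Cp (bad kind A a) (kind (p (Sum.inl i))) (y i.castSucc) (y i.succ)
  have step1 : ∀ b, ind (E1 kind D (mix a b) ∧
      ∑ i, ind (kind i = 0 ∧ bad kind A (mix a b) i) ≤ μ ∧ ∃ y, Cert kind A (mix a b) p d y) ≤
      ∑ y, ind (R y) * ind (∀ s, Q y s (b (p s))) := by
    intro b
    have e : ∀ y, ind (R y) * ind (∀ s, Q y s (b (p s))) = ind (R y ∧ ∀ s, Q y s (b (p s))) :=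
      fun y => (ind_and _ _).symm
    simp only [e]
    refine le_trans (ind_mono ?_) (ind_exists_le _)
    rintro ⟨-, -, y, hy⟩
    have hneg := hy.neg
    have hen : ∀ i o, en kind A (mix a b) (y i).1 o = en kind A a (y i).1 o := fun i o =>
      en_inv kind A hA (hag b) (hneg i) o
    have hPP : PP kind A (mix a b) = PP kind A a := PP_inv kind A hA (hag b)
    have hN2 : N2 kind (mix a b) y = N2 kind a y := N2_inv kind A hA (hag b) y hneg
    refine ⟨y, ⟨hneg, ?_⟩, ?_⟩
    · intro i hκ
      obtain ⟨h1, h2⟩ := hy.comp i hκ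
      exact ⟨fun ha hb => (bad_inv kind A hA (hag b) (hneg _)).1 (h1 ha hb),
        fun ha hb => (bad_inv kind A hA (hag b) (hneg _)).1 (h2 ha hb)⟩
    · rintro (i | _ | _)
      · have h1 := hy.intl i
        have h2 := hy.intr i
        have h3 := hy.inte i
        rw [hen] at h1 h2
        simp only [lf, rt, hmA, hPP] at h1 h2 h3
        exact ⟨by simp only [U, mem_singleton]; exact h1, by simp only [V, mem_singleton]; exact h2,
          h3⟩
      · have h1 := hy.el1
        have h2 := hy.el2
        rw [hen] at h1
        rw [hN2] at h2
        simp only [lf, rt, hmA] at h1 h2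
        exact ⟨h2, by simp only [V, mem_singleton]; exact h1, fun j h3 h4 => by
          simp only [κ] at h4; omega⟩
      · have h1 := hy.er1
        have h2 := hy.er2
        rw [hen] at h1
        rw [hN2] at h2
        simp only [lf, rt, hmA] at h1 h2
        exact ⟨by simp only [U, mem_singleton]; exact h1, h2, fun j h3 h4 => by
          simp only [κ] at h4; omega⟩
  refine (Ex_mono step1).trans ?_
  rw [Ex_sum]
  have hPPc : ((PP kind A a).card : ℝ) ≤ x * n := (PP_card kind A a hν).trans hx
  have step2 : ∀ y, Ex (fun b : Fin m → Fin 6 → Fin n =>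
      ind (R y) * ind (∀ s, Q y s (b (p s)))) ≤
      ind (R y) * ((∏ i : Fin t, (1 / (n : ℝ) ^ 2 * x ^ (kind (p (Sum.inl i)) - 2))) *
      (216 * D ^ 2 * (t + 1) / (n : ℝ) ^ 2) ^ 2) := by
    intro y
    rw [Ex_mul_left]
    apply mul_le_mul_of_nonneg_left _ (ind_nonneg _)
    have e := Ex_marg p hp (fun z : Fin t ⊕ Bool → Fin 6 → Fin n => ind (∀ s, Q y s (z s)))
    rw [e]
    change pr (fun z : Fin t ⊕ Bool → Fin 6 → Fin n => ∀ s, Q y s (z s)) ≤ _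
    rw [pr_pi (Q y), Fintype.prod_sum_type, Fintype.prod_bool]
    have hQ : ∀ s, pr (Q y s) ≤ (U y s).card * (V y s).card * (1 / (n : ℝ) ^ 2 * x ^ (κ s - 2)) := by
      intro s
      apply prQ hn (d s) (U y s) (V y s) (PP kind A a) (κ s) _ _ x hPPc
      · rcases s with i | _
        · exact (hk _).1
        · exact le_rfl
      · rcases s with i | _
        · exact (hk _).2
        · simp [κ]
    have hN : ((N2 kind a y).card : ℝ) ≤ 216 * D ^ 2 * (t + 1) := by
      exact_mod_cast N2_card kind hE1 y
    have hq1 : ∏ i : Fin t, pr (Q y (Sum.inl i)) ≤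
        ∏ i : Fin t, (1 / (n : ℝ) ^ 2 * x ^ (kind (p (Sum.inl i)) - 2)) := by
      apply Finset.prod_le_prod
      · intro i _; exact pr_nonneg _
      · intro i _
        have := hQ (Sum.inl i)
        simpa [U, V, κ] using this
    have hq2 : ∀ bb, pr (Q y (Sum.inr bb)) ≤ 216 * D ^ 2 * (t + 1) / (n : ℝ) ^ 2 := by
      intro bb
      have h1 := hQ (Sum.inr bb)
      have h2 : ((U y (Sum.inr bb)).card : ℝ) * (V y (Sum.inr bb)).card ≤ 216 * D ^ 2 * (t + 1) := by
        cases bb <;> simpa [U, V] using hN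
      refine h1.trans ?_
      have h3 : κ (Sum.inr bb) - 2 = 0 := by simp [κ]
      rw [h3, pow_zero, mul_one, mul_one_div]
      gcongr
    exact mul3 hq1 (hq2 true) (hq2 false) (Finset.prod_nonneg fun i _ => pr_nonneg _)
      (pr_nonneg _) (pr_nonneg _)
  refine (Finset.sum_le_sum fun y _ => step2 y).trans ?_
  rw [← Finset.sum_mul, mul_comm]
  apply mul_le_mul_of_nonneg_left _ (by positivity)
  exact chain_total (bad kind A a) (fun i => kind i = 0) hν hE3 t (fun i => kind (p (Sum.inl i)))

end

end KS

/-! ### First moment over certificates and the good events -/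

namespace KS

section
variable {n m : ℕ} (kind : Fin m → ℕ)

def CertEv (t D : ℕ) (μ : ℝ) (ω : Fin m → Fin 6 → Fin n) : Prop :=
  E1 kind D ω ∧ ∑ i, ind (kind i = 0 ∧ bad kind ∅ ω i) ≤ μ ∧
    ∃ (p : Fin t ⊕ Bool → Fin m) (d : Fin t ⊕ Bool → Bool), Function.Injective p ∧
      (∀ a, 2 ≤ kind (p a)) ∧ HH kind (univ.image p) ω = HH kind ∅ ω ∧
      ∃ y, Cert kind (univ.image p) ω p d y

theorem cert_sum (hn : 0 < n) (t D : ℕ) {ν μ x s2 s3 hA hG hE lam : ℝ}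
    (hk : ∀ i, kind i ≤ 4)
    (hν : ∑ i, ind (kind i = 0) ≤ ν) (hμ0 : 0 ≤ μ) (hx : 2 * ν ≤ x * n)
    (hA1 : 1 ≤ hA) (hG1 : 1 ≤ hG) (hE0 : 0 ≤ hE) (hl : 0 ≤ lam)
    (w : Fin m → ℝ) (hw0 : ∀ i, 0 ≤ w i)
    (hw : ∀ i, 2 ≤ kind i → w i = 2 * (1 / (n : ℝ) ^ 2 * x ^ (kind i - 2)))
    (h2 : ∑ i, ind (kind i = 2) * w i ≤ s2) (h3 : ∑ i, ind (kind i ≠ 2) * w i ≤ s3)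
    (iA : s2 * (μ * hA + ν * hG + μ * hE) + s3 * (ν * hA + ν * hG + μ * hE) ≤ lam * hA)
    (iG : s2 * (ν * hA) + s3 * (ν * hA + ν * hG + μ * hE) ≤ lam * hG)
    (iE : s2 * (ν * hG + μ * hE) ≤ lam * hE) :
    pr (CertEv (n := n) kind t D μ) ≤
      4 * (m : ℝ) ^ 2 * (216 * D ^ 2 * (t + 1) / (n : ℝ) ^ 2) ^ 2 *
        (lam ^ t * (ν * hA + ν * hG + μ * hE)) := by
  classical
  have hν0 : 0 ≤ ν := le_trans (Finset.sum_nonneg fun _ _ => ind_nonneg _) hν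
  have : Nonempty (Fin n) := ⟨⟨0, hn⟩⟩
  obtain ⟨wA, wG, wE⟩ := weight_bound kind w hw0 hν0 hμ0 hA1 hG1 hE0 hl h2 h3 iA iG iE t
  set c : ℝ := (216 * D ^ 2 * (t + 1) / (n : ℝ) ^ 2) ^ 2 with hc
  have hc0 : 0 ≤ c := by positivity
  let F : (Fin t → Fin m) → ℝ := fun q => (∏ i, w (q i)) *
    (ν * (W ν μ t (fun i => kind (q i))).1 + ν * (W ν μ t (fun i => kind (q i))).2.1 +
        μ * (W ν μ t (fun i => kind (q i))).2.2)
  have hF0 : ∀ q, 0 ≤ F q := by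
    intro q
    obtain ⟨g1, g2, g3⟩ := W_nonneg hν0 hμ0 t (fun i => kind (q i))
    apply mul_nonneg (Finset.prod_nonneg fun i _ => hw0 _)
    positivity
  let Ev : (Fin t ⊕ Bool → Fin m) → (Fin t ⊕ Bool → Bool) → (Fin m → Fin 6 → Fin n) → Prop :=
    fun p d ω => (Function.Injective p ∧ ∀ a, 2 ≤ kind (p a)) ∧ (E1 kind D ω ∧
      ∑ i, ind (kind i = 0 ∧ bad kind (univ.image p) ω i) ≤ μ ∧
      ∃ y, Cert kind (univ.image p) ω p d y)
  have hEv : ∀ p d, pr (Ev p d) ≤ F (fun i => p (Sum.inl i)) * c / 2 ^ t := by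
    intro p d
    by_cases h : Function.Injective p ∧ ∀ a, 2 ≤ kind (p a)
    · have h1 := cert_pr kind hn p d h.1 (fun a => ⟨h.2 a, hk _⟩) D hν hμ0 hx
      refine (pr_mono fun ω hω => hω.2).trans (h1.trans (le_of_eq ?_))
      have h4 : ∏ i : Fin t, w (p (Sum.inl i)) =
          2 ^ t * ∏ i : Fin t, (1 / (n : ℝ) ^ 2 * x ^ (kind (p (Sum.inl i)) - 2)) := by
        rw [Finset.prod_congr rfl (fun i _ => hw (p (Sum.inl i)) (h.2 _)), Finset.prod_mul_distrib]
        simp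
      simp only [F]
      rw [h4, ← hc]
      generalize ∏ i : Fin t, (1 / (n : ℝ) ^ 2 * x ^ (kind (p (Sum.inl i)) - 2)) = P
      clear_value c
      generalize (W ν μ t fun i => kind (p (Sum.inl i))) = Wx
      field_simp
    · have : pr (Ev p d) = 0 := by
        unfold pr
        have : ∀ ω, ind (Ev p d ω) = 0 := fun ω => ind_false fun hω => h hω.1
        simp only [this]; exact Ex_const 0
      rw [this]
      have := hF0 (fun i => p (Sum.inl i))
      positivity
  have hsub : pr (CertEv (n := n) kind t D μ) ≤ pr (fun ω => ∃ p d, Ev p d ω) := by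
    apply pr_mono
    rintro ω ⟨hE1, hE3, p, d, hp, hk2, hH, y, hy⟩
    refine ⟨p, d, ⟨hp, hk2⟩, hE1, ?_, y, hy⟩
    have : ∀ i, bad kind (univ.image p) ω i ↔ bad kind ∅ ω i := by
      intro i; unfold bad; rw [hH]
    simp only [this]; exact hE3
  refine hsub.trans ((pr_exists _).trans ?_)
  calc ∑ p, pr (fun ω => ∃ d, Ev p d ω) ≤ ∑ p : Fin t ⊕ Bool → Fin m,
        (4 * c * F (fun i => p (Sum.inl i))) := by
        apply Finset.sum_le_sum; intro p _
        refine (pr_exists _).trans ((Finset.sum_le_sum fun d _ => hEv p d).trans (le_of_eq ?_))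
        simp only [Finset.sum_const, card_univ, Fintype.card_fun, Fintype.card_bool,
          Fintype.card_sum, Fintype.card_fin, nsmul_eq_mul]
        push_cast
        rw [pow_add]; field_simp; ring
    _ = ∑ x : (Fin t → Fin m) × (Bool → Fin m), (4 * c * F x.1) := by
        apply Fintype.sum_equiv (Equiv.sumArrowEquivProdArrow (Fin t) Bool (Fin m))
        intro p; rfl
    _ = 4 * (m : ℝ) ^ 2 * c * ∑ q, F q := by
        rw [Fintype.sum_prod_type]
        simp only [Finset.sum_const, card_univ, Fintype.card_fun, Fintype.card_bool,
          Fintype.card_fin, nsmul_eq_mul]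
        rw [Finset.mul_sum]
        apply Finset.sum_congr rfl; intro q _; push_cast; ring
    _ ≤ _ := by
        apply mul_le_mul_of_nonneg_left _ (by positivity)
        have e : ∑ q, F q = ν * ∑ q : Fin t → Fin m, (∏ i, w (q i)) *
            (W ν μ t (fun i => kind (q i))).1 + ν * ∑ q : Fin t → Fin m, (∏ i, w (q i)) *
            (W ν μ t (fun i => kind (q i))).2.1 + μ * ∑ q : Fin t → Fin m, (∏ i, w (q i)) *
            (W ν μ t (fun i => kind (q i))).2.2 := by
          rw [Finset.mul_sum, Finset.mul_sum, Finset.mul_sum, ← Finset.sum_add_distrib,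
            ← Finset.sum_add_distrib]
          apply Finset.sum_congr rfl; intro q _; simp only [F]; ring
        rw [e]
        calc _ ≤ ν * (lam ^ t * hA) + ν * (lam ^ t * hG) + μ * (lam ^ t * hE) := by gcongr
          _ = _ := by ring

lemma pr_coord {X Y : Type*} [Fintype X] [DecidableEq X] [Fintype Y] [Nonempty Y] (T : Finset X)
    (C : X → Y → Prop) :
    pr (fun z : X → Y => ∀ j ∈ T, C j (z j)) = ∏ j ∈ T, pr (C j) := by
  classical
  rw [pr_pi (fun j (v : Y) => j ∈ T → C j v)]
  rw [← Finset.prod_subset (Finset.subset_univ T)]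
  · apply Finset.prod_congr rfl; intro j hj; simp [hj]
  · intro j _ hj
    simp only [hj, false_imp_iff]
    unfold pr
    simp only [ind_true]; exact Ex_const 1

lemma pr_coord1 {X Y : Type*} [Fintype X] [DecidableEq X] [Fintype Y] [Nonempty Y] (j : X)
    (C : Y → Prop) : pr (fun z : X → Y => C (z j)) = pr C := by
  have := pr_coord {j} (fun _ : X => C)
  simpa using this

lemma E1_pr (hn : 0 < n) {b : ℝ} (hν : ∑ i, ind (kind i = 0) ≤ b * n) :
    pr (fun ω : Fin m → Fin 6 → Fin n => ¬ E1 kind (2 * (Nat.log 2 n + 1)) ω) ≤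
      Real.exp (6 * b) / n := by
  classical
  have : Nonempty (Fin n) := ⟨⟨0, hn⟩⟩
  have hn' : (0 : ℝ) < n := by exact_mod_cast hn
  set D := 2 * (Nat.log 2 n + 1) with hD
  let T : Finset (Fin m) := univ.filter fun i => kind i = 0
  have hT : (T.card : ℝ) ≤ b * n := by
    refine le_trans (le_of_eq ?_) hν
    simp only [T]
    rw [Finset.card_filter]; push_cast
    apply Finset.sum_congr rfl; intro i _; unfold ind; split_ifs <;> rfl
  have h1 : ∀ v : Fin n, pr (fun ω : Fin m → Fin 6 → Fin n =>
      D ≤ (T.filter fun i => ∃ j, ω i j = v).card) ≤ Real.exp (6 * b) / (n : ℝ) ^ 2 := by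
    intro v
    have hE : ∀ i ∈ T, pr (fun x : Fin 6 → Fin n => ∃ j, x j = v) ≤ 6 / n := by
      intro i _
      refine (pr_exists _).trans (le_of_eq ?_)
      have : ∀ j : Fin 6, pr (fun x : Fin 6 → Fin n => x j = v) = 1 / n := by
        intro j
        rw [pr_coord1 j (fun y => y = v)]
        have := pr_mem ({v} : Finset (Fin n))
        simpa using this
      simp only [this]
      simp; ring
    have h2 := tail T (fun _ (x : Fin 6 → Fin n) => ∃ j, x j = v) (6 / n) 1 one_pos hE D
    refine (le_trans (le_of_eq ?_) h2).trans ?_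
    · congr!
    have h3 : (1 + 1 * (6 / (n : ℝ))) ^ T.card ≤ Real.exp (6 * b) := by
      calc (1 + 1 * (6 / (n : ℝ))) ^ T.card ≤ (Real.exp (6 / n)) ^ T.card := by
            gcongr; linarith [Real.add_one_le_exp (6 / (n : ℝ))]
        _ = Real.exp (6 * (T.card / n)) := by rw [← Real.exp_nat_mul]; ring_nf
        _ ≤ _ := by
            apply Real.exp_le_exp.2
            have : (T.card : ℝ) / n ≤ b := by rw [div_le_iff₀ hn']; exact hT
            linarith
    have h4 : (n : ℝ) ^ 2 ≤ (1 + 1) ^ D := by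
      have h5 : n < 2 ^ (Nat.log 2 n + 1) := Nat.lt_pow_succ_log_self (by norm_num) n
      have h6 : (n : ℝ) ≤ 2 ^ (Nat.log 2 n + 1) := by exact_mod_cast h5.le
      rw [hD, mul_comm 2, pow_mul]; norm_num
      gcongr
    gcongr
  calc _ ≤ pr (fun ω : Fin m → Fin 6 → Fin n => ∃ v,
        D ≤ (T.filter fun i => ∃ j, ω i j = v).card) := by
        apply pr_mono
        intro ω hω
        unfold E1 at hω; push Not at hω
        obtain ⟨v, hv⟩ := hω
        refine ⟨v, le_trans hv.le (le_of_eq ?_)⟩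
        congr 1; ext c; simp [T]
    _ ≤ ∑ v : Fin n, Real.exp (6 * b) / (n : ℝ) ^ 2 :=
        (pr_exists _).trans (Finset.sum_le_sum fun v _ => h1 v)
    _ = _ := by simp; field_simp

open Classical in
def E2 (γ : ℝ) (ω : Fin m → Fin 6 → Fin n) : Prop :=
  ((univ.filter fun p => kind p = 2 ∧ (ω p 0 ∈ SS kind ω ∨ ω p 1 ∈ SS kind ω)).card : ℝ) ≤ γ * n

lemma card_le_of_sub {s : Finset (Fin n)} {ν : ℝ} (hν : ∑ i, ind (kind i = 0) ≤ ν)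
    (f : Fin m → Fin n) (hs : ∀ v ∈ s, ∃ i, kind i = 0 ∧ f i = v) : (s.card : ℝ) ≤ ν := by
  classical
  have h1 : s ⊆ (univ.filter fun i => kind i = 0).image f := by
    intro v hv
    obtain ⟨i, hi, h⟩ := hs v hv
    simp only [mem_image, mem_filter, mem_univ, true_and]; exact ⟨i, hi, h⟩
  have h2 : s.card ≤ (univ.filter fun i => kind i = 0).card :=
    (card_le_card h1).trans card_image_le
  have h3 : ((univ.filter fun i => kind i = 0).card : ℝ) = ∑ i, ind (kind i = 0) := by
    rw [Finset.card_filter]; push_cast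
    apply Finset.sum_congr rfl; intro i _; unfold ind; split_ifs <;> rfl
  have h4 : (s.card : ℝ) ≤ ((univ.filter fun i => kind i = 0).card : ℝ) := by exact_mod_cast h2
  linarith

lemma SS_card {ν : ℝ} (hν : ∑ i, ind (kind i = 0) ≤ ν) (ω : Fin m → Fin 6 → Fin n) :
    ((SS kind ω).card : ℝ) ≤ ν :=
  card_le_of_sub kind hν (fun i => ω i 0) fun v hv => by
    simpa [SS] using hv

lemma KK_card {ν : ℝ} (hν : ∑ i, ind (kind i = 0) ≤ ν) (ω : Fin m → Fin 6 → Fin n) :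
    ((KK kind ω).card : ℝ) ≤ ν :=
  card_le_of_sub kind hν (fun i => ω i 5) fun v hv => by
    simpa [KK] using hv

lemma HH_card {b γ : ℝ} (hν : ∑ i, ind (kind i = 0) ≤ b * n) (ω : Fin m → Fin 6 → Fin n)
    (h : E2 kind γ ω) : ((HH kind ∅ ω).card : ℝ) ≤ (2 * b + γ) * n := by
  classical
  have hI : II kind ∅ ω ⊆ (univ.filter fun p => kind p = 2 ∧
      (ω p 0 ∈ SS kind ω ∨ ω p 1 ∈ SS kind ω)).image
      fun p => if ω p 1 ∈ SS kind ω then ω p 0 else ω p 1 := by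
    intro v hv
    simp only [II, mem_filter, mem_univ, true_and] at hv
    obtain ⟨h1, -, p, -, hp, h4⟩ := hv
    simp only [mem_image, mem_filter, mem_univ, true_and]
    rcases h4 with ⟨h4, h5⟩ | ⟨h4, h5⟩
    · exact ⟨p, ⟨hp, Or.inr h5⟩, by rw [if_pos h5, h4]⟩
    · exact ⟨p, ⟨hp, Or.inl h5⟩, by rw [if_neg (by rw [h4]; exact h1), h4]⟩
  have hI2 := (card_le_card hI).trans card_image_le
  have hI3 : ((II kind ∅ ω).card : ℝ) ≤ γ * n := le_trans (by exact_mod_cast hI2) h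
  have h5 : (HH kind ∅ ω).card ≤ (SS kind ω).card + (KK kind ω).card + (II kind ∅ ω).card := by
    unfold HH
    exact (card_union_le _ _).trans (Nat.add_le_add_right (card_union_le _ _) _)
  have h6 : ((HH kind ∅ ω).card : ℝ) ≤ (SS kind ω).card + (KK kind ω).card +
    (II kind ∅ ω).card := by exact_mod_cast h5
  have h7 := SS_card kind hν ω
  have h8 := KK_card kind hν ω
  linarith

end

lemma E2_pr (b α2 δ : ℝ) (hb : 0 ≤ b) (hα : 0 ≤ α2) (hδ : 0 < δ) : ∃ c : ℝ, 0 < c ∧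
    ∀ (n m : ℕ) (kind : Fin m → ℕ), 0 < n → ∑ i, ind (kind i = 0) ≤ b * n →
    ∑ i, ind (kind i = 2) ≤ α2 * n →
    pr (fun ω : Fin m → Fin 6 → Fin n => ¬ E2 kind (2 * b * α2 + δ) ω) ≤ Real.exp (-(c * n)) := by
  classical
  obtain ⟨c, hc, H⟩ := tail_exp (2 * b * α2) δ (by positivity) hδ
  refine ⟨c, hc, ?_⟩
  intro n m kind hn hν h2
  have : Nonempty (Fin n) := ⟨⟨0, hn⟩⟩
  have hn' : (0 : ℝ) < n := by exact_mod_cast hn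
  let mix : (Fin m → Fin 6 → Fin n) → (Fin m → Fin 6 → Fin n) → (Fin m → Fin 6 → Fin n) :=
    fun a b i => if kind i = 0 then a i else b i
  have hmix : ∀ a b, mix (mix a b) (mix b a) = a := by
    intro a b; funext i; simp only [mix]; split_ifs <;> rfl
  unfold pr
  rw [Ex_mix mix hmix]
  apply Ex_le_const
  intro a
  have hS : ∀ b, SS kind (mix a b) = SS kind a := fun b =>
    SS_inv kind fun i hi => by simp [mix, hi]
  let T : Finset (Fin m) := univ.filter fun i => kind i = 2
  have hT : (T.card : ℝ) ≤ α2 * n := by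
    refine le_trans (le_of_eq ?_) h2
    simp only [T]
    rw [Finset.card_filter]; push_cast
    apply Finset.sum_congr rfl; intro i _; unfold ind; split_ifs <;> rfl
  have hc1 : ∀ j : Fin 6, pr (fun x : Fin 6 → Fin n => x j ∈ SS kind a) ≤ b := by
    intro j
    rw [pr_coord1 j (fun y => y ∈ SS kind a), pr_mem, Fintype.card_fin, div_le_iff₀ hn']
    exact SS_card kind hν a
  have h3 := H T (fun _ (x : Fin 6 → Fin n) => x 0 ∈ SS kind a ∨ x 1 ∈ SS kind a) (2 * b) n
    (by positivity) (fun i _ => (pr_or _ _).trans (by linarith [hc1 0, hc1 1]))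
    (by rw [mul_assoc (2 * b)]; gcongr)
  refine le_trans (Ex_mono fun b' => ind_mono ?_) h3
  intro h
  unfold E2 at h
  push Not at h
  refine le_trans h.le (le_of_eq ?_)
  congr 2
  ext p
  simp only [mem_filter, mem_univ, true_and, T, hS]
  apply and_congr_right; intro hp
  have : mix a b' p = b' p := by simp [mix, hp]
  rw [this]

lemma E3_pr (b γ ι φ : ℝ) (hb : 0 < b) (hι : 2 * b + γ ≤ ι) (hι0 : 0 ≤ ι) (hφ : ι ^ 4 < φ) :
    ∃ c : ℝ, 0 < c ∧
    ∀ (n m : ℕ) (kind : Fin m → ℕ), 0 < n → ∑ i, ind (kind i = 0) ≤ b * n →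
    pr (fun ω : Fin m → Fin 6 → Fin n => E2 kind γ ω ∧
      ¬ (∑ i, ind (kind i = 0 ∧ bad kind ∅ ω i) ≤ φ * b * n)) ≤ Real.exp (-(c * n)) := by
  classical
  obtain ⟨c, hc, H⟩ := tail_exp (ι ^ 4 * b) ((φ - ι ^ 4) * b) (by positivity)
    (mul_pos (by linarith) hb)
  refine ⟨c, hc, ?_⟩
  intro n m kind hn hν
  have : Nonempty (Fin n) := ⟨⟨0, hn⟩⟩
  have hn' : (0 : ℝ) < n := by exact_mod_cast hn
  let mix : (Fin m → Fin 6 → Fin n) → (Fin m → Fin 6 → Fin n) → (Fin m → Fin 6 → Fin n) :=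
    fun a b i j => if kind i = 0 ∧ j ≠ 0 ∧ j ≠ 5 then b i j else a i j
  have hmix : ∀ a b, mix (mix a b) (mix b a) = a := by
    intro a b; funext i j; simp only [mix]; split_ifs <;> rfl
  unfold pr
  rw [Ex_mix mix hmix]
  apply Ex_le_const
  intro a
  have hS : ∀ b, SS kind (mix a b) = SS kind a := fun b => SS_inv kind fun i hi => by simp [mix]
  have hH : ∀ b, HH kind ∅ (mix a b) = HH kind ∅ a := fun b =>
    HH_inv kind ∅ (fun i hi => by simp [mix]) (fun i hi => by simp [mix])
      (fun i _ hi => by simp [mix, hi])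
  have hE2 : ∀ b, E2 kind γ (mix a b) → E2 kind γ a := by
    intro b h
    refine le_trans (le_of_eq ?_) h
    congr 2
    ext p
    simp only [mem_filter, mem_univ, true_and, hS]
    apply and_congr_right; intro hp
    simp [mix, hp]
  by_cases hE : E2 kind γ a
  swap
  · have : ∀ b', ind (E2 kind γ (mix a b') ∧
      ¬ (∑ i, ind (kind i = 0 ∧ bad kind ∅ (mix a b') i) ≤ φ * b * n)) = 0 := fun b' =>
      ind_false fun h => hE (hE2 b' h.1)
    simp only [this]
    rw [Ex_const]; positivity
  have hHc : ((HH kind ∅ a).card : ℝ) / n ≤ ι := by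
    rw [div_le_iff₀ hn']
    refine (HH_card kind hν a hE).trans ?_
    gcongr
  let T : Finset (Fin m) := univ.filter fun i => kind i = 0
  have hT : (T.card : ℝ) ≤ b * n := by
    refine le_trans (le_of_eq ?_) hν
    simp only [T]
    rw [Finset.card_filter]; push_cast
    apply Finset.sum_congr rfl; intro i _; unfold ind; split_ifs <;> rfl
  have hbad : pr (fun x : Fin 6 → Fin n => badx (HH kind ∅ a) x) ≤ ι ^ 4 := by
    have h1 := pr_coord ({1, 2, 3, 4} : Finset (Fin 6)) (fun _ (v : Fin n) => v ∈ HH kind ∅ a)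
    rw [Finset.prod_const, pr_mem, Fintype.card_fin,
      show ({1, 2, 3, 4} : Finset (Fin 6)).card = 4 by decide] at h1
    have h2 : pr (fun x : Fin 6 → Fin n => badx (HH kind ∅ a) x) ≤
        (((HH kind ∅ a).card : ℝ) / n) ^ 4 := by
      rw [← h1]
      apply pr_mono
      intro x hx j hj
      have : j ≠ 0 ∧ j ≠ 5 := by revert hj; revert j; decide
      exact hx j this.1 this.2
    refine h2.trans ?_
    gcongr
  have h3 := H T (fun _ (x : Fin 6 → Fin n) => badx (HH kind ∅ a) x) (ι ^ 4) n
    (by positivity) (fun i _ => hbad)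
    (by rw [mul_assoc (ι ^ 4)]; gcongr)
  refine le_trans (Ex_mono fun b' => ind_mono ?_) h3
  rintro ⟨-, h⟩
  push Not at h
  rw [show ι ^ 4 * b + (φ - ι ^ 4) * b = φ * b by ring]
  refine le_trans h.le (le_of_eq ?_)
  rw [Finset.filter_filter, Finset.card_filter]
  push_cast
  apply Finset.sum_congr rfl
  intro i _
  have : (kind i = 0 ∧ bad kind ∅ (mix a b') i) ↔ (kind i = 0 ∧ badx (HH kind ∅ a) (b' i)) := by
    apply and_congr_right; intro hi
    unfold bad; rw [hH]; unfold badx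
    apply forall_congr'; intro j; apply imp_congr_right; intro h0; apply imp_congr_right; intro h5
    simp [mix, hi, h0, h5]
  rw [propext this]
  unfold ind; split_ifs <;> rfl

end KS

/-! ### The core estimate -/

namespace KS

lemma sum_sq_geom (lam : ℝ) (h0 : 0 ≤ lam) (h1 : lam < 1) :
    ∃ S : ℝ, 0 ≤ S ∧ ∀ m : ℕ, ∑ t : Fin m, ((t : ℝ) + 1) ^ 2 * lam ^ (t : ℕ) ≤ S := by
  have s1 : Summable fun t : ℕ => (t : ℝ) ^ 2 * lam ^ t :=
    summable_pow_mul_geometric_of_norm_lt_one 2 (by rwa [Real.norm_of_nonneg h0])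
  have s2 : Summable fun t : ℕ => lam ^ t := summable_geometric_of_lt_one h0 h1
  have s3 := (s1.mul_left 2).add (s2.mul_left 2)
  refine ⟨∑' t : ℕ, (2 * ((t : ℝ) ^ 2 * lam ^ t) + 2 * lam ^ t),
    tsum_nonneg fun t => by positivity, fun m => ?_⟩
  rw [Fin.sum_univ_eq_sum_range (fun t : ℕ => ((t : ℝ) + 1) ^ 2 * lam ^ t)]
  refine le_trans (Finset.sum_le_sum fun t _ => ?_) (s3.sum_le_tsum (range m) fun t _ => by positivity)
  have : ((t : ℝ) + 1) ^ 2 ≤ 2 * (t : ℝ) ^ 2 + 2 := by nlinarith [sq_nonneg ((t : ℝ) - 1)]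
  calc _ ≤ (2 * (t : ℝ) ^ 2 + 2) * lam ^ t := by gcongr
    _ = _ := by ring

lemma log_pow_lim : Tendsto (fun n : ℕ => ((2 * (Nat.log 2 n + 1) : ℕ) : ℝ) ^ 4 / n) atTop
    (nhds 0) := by
  have h1 : Tendsto (fun n : ℕ => 6 ^ 4 * (Real.log n ^ 4 / (n : ℝ))) atTop (nhds 0) := by
    have h := (Real.isLittleO_pow_log_id_atTop (n := 4)).tendsto_div_nhds_zero
    have h2 := (h.comp tendsto_natCast_atTop_atTop).const_mul ((6 : ℝ) ^ 4)
    simpa using h2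
  refine tendsto_of_tendsto_of_tendsto_of_le_of_le' tendsto_const_nhds h1
    (Eventually.of_forall fun n => by positivity) ?_
  filter_upwards [eventually_ge_atTop 3] with n hn
  have hn' : (3 : ℝ) ≤ n := by exact_mod_cast hn
  have hl1 : 1 ≤ Real.log n := by
    rw [Real.le_log_iff_exp_le (by linarith)]
    exact Real.exp_one_lt_three.le.trans hn'
  have h2 : (Nat.log 2 n : ℝ) * Real.log 2 ≤ Real.log n := by
    rw [← Real.log_pow]
    apply Real.log_le_log (by positivity)
    have : 2 ^ Nat.log 2 n ≤ n := Nat.pow_log_le_self 2 (by omega)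
    exact_mod_cast this
  have h3 := Real.log_two_gt_d9
  have h4 : (Nat.log 2 n : ℝ) ≤ 2 * Real.log n := by
    have : (0 : ℝ) ≤ Nat.log 2 n := by positivity
    nlinarith
  have h5 : ((2 * (Nat.log 2 n + 1) : ℕ) : ℝ) ≤ 6 * Real.log n := by push_cast; linarith
  calc _ ≤ (6 * Real.log n) ^ 4 / n := by gcongr
    _ = _ := by ring

theorem core (b α2 α3 M ι φ hA hG hE lam : ℝ) (hb : 0 < b) (hα2 : 0 ≤ α2) (hα3 : 0 ≤ α3)
    (hM : 0 ≤ M) (hι : 2 * b + 2 * b * α2 < ι) (hφ : ι ^ 4 < φ)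
    (hA1 : 1 ≤ hA) (hG1 : 1 ≤ hG) (hE0 : 0 ≤ hE) (hl : 0 ≤ lam) (hl1 : lam < 1)
    (iA : 2 * b * α2 * (φ * hA + hG + φ * hE) +
      (4 * b ^ 2 * α3 + 8 * b ^ 3 * M) * (hA + hG + φ * hE) ≤ lam * hA)
    (iG : 2 * b * α2 * hA +
      (4 * b ^ 2 * α3 + 8 * b ^ 3 * M) * (hA + hG + φ * hE) ≤ lam * hG)
    (iE : 2 * b * α2 * (hG + φ * hE) ≤ lam * hE) :
    ∃ ε : ℕ → ℝ, Tendsto ε atTop (nhds 0) ∧ ∀ (n m : ℕ) (kind : Fin m → ℕ), 0 < n →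
      (∀ i, kind i = 0 ∨ kind i = 2 ∨ kind i = 3 ∨ kind i = 4) →
      ∑ i, ind (kind i = 0) ≤ b * n → ∑ i, ind (kind i = 2) ≤ α2 * n →
      ∑ i, ind (kind i = 3) ≤ α3 * n → (m : ℝ) ≤ M * n →
      pr (fun ω : Fin m → Fin 6 → Fin n => BadE kind ω) ≤ ε n := by
  classical
  have hι0 : 0 ≤ ι := le_trans (by positivity) hι.le
  have hφ0 : 0 ≤ φ := le_trans (by positivity) hφ.le
  obtain ⟨c2, hc2, H2⟩ := E2_pr b α2 (ι - 2 * b - 2 * b * α2) hb.le hα2 (by linarith)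
  obtain ⟨c3, hc3, H3⟩ := E3_pr b (2 * b * α2 + (ι - 2 * b - 2 * b * α2)) ι φ hb
    (by linarith) hι0 hφ
  obtain ⟨S, hS0, hS⟩ := sum_sq_geom lam hl hl1
  set γ := 2 * b * α2 + (ι - 2 * b - 2 * b * α2)
  let K : ℝ := 4 * M ^ 2 * 216 ^ 2 * (b * hA + b * hG + φ * b * hE) * S
  refine ⟨fun n => Real.exp (6 * b) / n + Real.exp (-(c2 * n)) + Real.exp (-(c3 * n)) +
    K * (((2 * (Nat.log 2 n + 1) : ℕ) : ℝ) ^ 4 / n), ?_, ?_⟩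
  · have e : ∀ c : ℝ, 0 < c → Tendsto (fun n : ℕ => Real.exp (-(c * n))) atTop (nhds 0) := by
      intro c hc
      apply Real.tendsto_exp_neg_atTop_nhds_zero.comp
      exact tendsto_natCast_atTop_atTop.const_mul_atTop hc
    have := (((tendsto_const_div_atTop_nhds_zero_nat (Real.exp (6 * b))).add (e c2 hc2)).add
      (e c3 hc3)).add (log_pow_lim.const_mul K)
    simpa using this
  intro n m kind hn hkind h0 h2 h3 hm
  have hn' : (0 : ℝ) < n := by exact_mod_cast hn
  have : Nonempty (Fin n) := ⟨⟨0, hn⟩⟩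
  set D := 2 * (Nat.log 2 n + 1) with hD
  let μ : ℝ := φ * b * n
  let w : Fin m → ℝ := fun i => if 2 ≤ kind i then 2 * (1 / (n : ℝ) ^ 2 * (2 * b) ^ (kind i - 2))
    else 0
  have hw0 : ∀ i, 0 ≤ w i := by
    intro i; simp only [w]; split_ifs
    · positivity
    · exact le_rfl
  have hw : ∀ i, 2 ≤ kind i → w i = 2 * (1 / (n : ℝ) ^ 2 * (2 * b) ^ (kind i - 2)) := by
    intro i hi; simp only [w]; rw [if_pos hi]
  have hs2 : ∑ i, ind (kind i = 2) * w i ≤ 2 * α2 / n := by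
    calc ∑ i, ind (kind i = 2) * w i = (2 / (n : ℝ) ^ 2) * ∑ i, ind (kind i = 2) := by
          rw [Finset.mul_sum]; apply Finset.sum_congr rfl; intro i _
          by_cases h : kind i = 2
          · rw [hw i h.ge, h]; norm_num; ring
          · rw [ind_false h]; ring
      _ ≤ (2 / (n : ℝ) ^ 2) * (α2 * n) := by gcongr
      _ = _ := by field_simp
  have hs3 : ∑ i, ind (kind i ≠ 2) * w i ≤ (4 * b * α3 + 8 * b ^ 2 * M) / n := by
    calc ∑ i, ind (kind i ≠ 2) * w i ≤ ∑ i : Fin m, ((4 * b / (n : ℝ) ^ 2) * ind (kind i = 3) +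
          8 * b ^ 2 / (n : ℝ) ^ 2) := by
          apply Finset.sum_le_sum; intro i _
          rcases hkind i with h | h | h | h
          · have : w i = 0 := by simp [w, h]
            rw [this, mul_zero]
            have := ind_nonneg (kind i = 3)
            positivity
          · rw [ind_false (by simp [h])]
            have := ind_nonneg (kind i = 3)
            rw [zero_mul]; positivity
          · rw [hw i (by omega), ind_true h, ind_true (by omega), h]
            have : 0 ≤ 8 * b ^ 2 / (n : ℝ) ^ 2 := by positivity
            have e : (1 : ℝ) * (2 * (1 / (n : ℝ) ^ 2 * (2 * b) ^ (3 - 2))) =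
              4 * b / (n : ℝ) ^ 2 * 1 := by norm_num; ring
            rw [e]; linarith
          · rw [hw i (by omega), ind_true (show kind i ≠ 2 by omega),
              ind_false (show ¬ kind i = 3 by omega), h]
            apply le_of_eq; norm_num; ring
      _ = (4 * b / (n : ℝ) ^ 2) * ∑ i, ind (kind i = 3) + m * (8 * b ^ 2 / (n : ℝ) ^ 2) := by
          rw [Finset.sum_add_distrib, Finset.mul_sum]; simp
      _ ≤ (4 * b / (n : ℝ) ^ 2) * (α3 * n) + (M * n) * (8 * b ^ 2 / (n : ℝ) ^ 2) := by gcongr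
      _ = _ := by field_simp
  have hC : ∀ t : ℕ, pr (CertEv (n := n) kind t D μ) ≤
      4 * M ^ 2 * 216 ^ 2 * (b * hA + b * hG + φ * b * hE) * ((D : ℝ) ^ 4 / n) *
        (((t : ℝ) + 1) ^ 2 * lam ^ t) := by
    intro t
    have h := cert_sum (ν := b * n) (μ := μ) (x := 2 * b) (hA := hA) (hG := hG) (hE := hE)
      (lam := lam) kind hn t D (fun i => by have := hkind i; omega) h0 (by positivity)
      (by linarith) hA1 hG1 hE0 hl w hw0 hw hs2 hs3
      (le_trans (le_of_eq (by simp only [μ]; field_simp)) iA)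
      (le_trans (le_of_eq (by simp only [μ]; field_simp)) iG)
      (le_trans (le_of_eq (by simp only [μ]; field_simp)) iE)
    refine h.trans ?_
    calc _ ≤ 4 * (M * n) ^ 2 * (216 * (D : ℝ) ^ 2 * (t + 1) / (n : ℝ) ^ 2) ^ 2 *
        (lam ^ t * (b * n * hA + b * n * hG + μ * hE)) := by gcongr
      _ = _ := by simp only [μ]; field_simp
  have hsub : pr (fun ω : Fin m → Fin 6 → Fin n => BadE kind ω) ≤
      pr (fun ω : Fin m → Fin 6 → Fin n => ((¬ E1 kind D ω ∨ ¬ E2 kind γ ω) ∨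
        (E2 kind γ ω ∧ ¬ (∑ i, ind (kind i = 0 ∧ bad kind ∅ ω i) ≤ φ * b * n))) ∨
        ∃ t : Fin m, CertEv kind t D μ ω) := by
    apply pr_mono
    intro ω hω
    by_cases h1 : E1 kind D ω
    swap; · exact Or.inl (Or.inl (Or.inl h1))
    by_cases h2 : E2 kind γ ω
    swap; · exact Or.inl (Or.inl (Or.inr h2))
    by_cases h3 : ∑ i, ind (kind i = 0 ∧ bad kind ∅ ω i) ≤ φ * b * n
    swap; · exact Or.inl (Or.inr ⟨h2, h3⟩)
    right
    obtain ⟨t, p, d, hp, hk2, hH, y, hy⟩ :=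
      exists_cert kind ω (fun i hi => by have := hkind i; omega) hω
    have hcard := Fintype.card_le_of_injective p hp
    simp only [Fintype.card_sum, Fintype.card_fin, Fintype.card_bool] at hcard
    exact ⟨⟨t, by omega⟩, h1, h3, p, d, hp, hk2, hH, y, hy⟩
  refine hsub.trans ((pr_or _ _).trans ?_)
  refine add_le_add ((pr_or _ _).trans (add_le_add ((pr_or _ _).trans (add_le_add ?_ ?_)) ?_)) ?_
  · exact E1_pr kind hn h0
  · exact H2 n m kind hn h0 h2
  · exact H3 n m kind hn h0
  · refine (pr_exists _).trans ((Finset.sum_le_sum fun (t : Fin m) _ => hC t.1).trans ?_)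
    rw [← Finset.mul_sum]
    calc _ ≤ 4 * M ^ 2 * 216 ^ 2 * (b * hA + b * hG + φ * b * hE) * ((D : ℝ) ^ 4 / n) * S := by
          gcongr; exact hS m
      _ = _ := by simp only [K]; ring

end KS

/-! ### From clauses to lists of literals -/

namespace KS

/-- number of positive signs -/
def pc {k : ℕ} (z : Fin k → Bool) : ℕ := (univ.filter fun j => z j = true).card

/-- index selected by the rule, as a function of the signs -/
def selI {k : ℕ} (x : Fin 3 → Fin k → Bool) : Fin 3 :=
  if 2 ≤ pc (x 0) then 0 else if 2 ≤ pc (x 1) then 1 else 2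

def kd {k : ℕ} (x : Fin 3 → Fin k → Bool) : ℕ :=
  if pc (x (selI x)) ≤ 1 then 0 else min (pc (x (selI x))) 4

lemma exists_order {k : ℕ} (hk : 6 ≤ k) (p : Fin k → Bool) : ∃ ρ : Fin 6 → Fin k,
    Function.Injective ρ ∧ ∀ j : Fin 6, j.1 < pc p → p (ρ j) = true := by
  classical
  set l1 := (univ.filter fun j => p j = true).toList with h1
  set l2 := (univ.filter fun j => ¬ p j = true).toList with h2
  have hlen1 : l1.length = pc p := by rw [h1, Finset.length_toList]; rfl
  have hlen : (l1 ++ l2).length = k := by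
    rw [List.length_append, h1, h2, Finset.length_toList, Finset.length_toList,
      Finset.card_filter_add_card_filter_not]
    simp
  have hnd : (l1 ++ l2).Nodup := by
    rw [List.nodup_append]
    refine ⟨Finset.nodup_toList _, Finset.nodup_toList _, ?_⟩
    intro a ha b hb hab
    rw [h1, Finset.mem_toList] at ha
    rw [h2, Finset.mem_toList] at hb
    subst hab
    exact (Finset.mem_filter.1 hb).2 (Finset.mem_filter.1 ha).2
  refine ⟨fun j => (l1 ++ l2)[j.1]'(by omega), ?_, ?_⟩
  · intro a b hab
    exact Fin.ext ((hnd.getElem_inj_iff).1 hab)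
  · intro j hj
    have hj1 : j.1 < l1.length := by omega
    have e : (l1 ++ l2)[j.1]'(by omega) = l1[j.1] := List.getElem_append_left hj1
    simp only
    rw [e]
    have hall : ∀ a ∈ l1, p a = true := by
      intro a ha
      rw [h1, Finset.mem_toList] at ha
      exact (Finset.mem_filter.1 ha).2
    exact hall _ (List.getElem_mem hj1)

lemma pc_not {k : ℕ} (z : Fin k → Bool) : pc (fun j => !z j) + pc z = k := by
  unfold pc
  have := Finset.card_filter_add_card_filter_not (s := (univ : Finset (Fin k)))
    (fun j => z j = true)
  simp only [card_univ, Fintype.card_fin, Bool.not_eq_true] at this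
  simp only [Bool.not_eq_true']
  omega

lemma exists_rho {k : ℕ} (hk : 7 ≤ k) (x : Fin 3 → Fin k → Bool) : ∃ ρ : Fin 6 → Fin k,
    Function.Injective ρ ∧ (kd x = 0 → ∀ j, x (selI x) (ρ j) = false) ∧
      (kd x ≠ 0 → ∀ j : Fin 6, j.1 < kd x → x (selI x) (ρ j) = true) := by
  by_cases h : pc (x (selI x)) ≤ 1
  · obtain ⟨ρ, h1, h2⟩ := exists_order (by omega) (fun j => !x (selI x) j)
    have := pc_not (x (selI x))
    refine ⟨ρ, h1, fun _ j => ?_, fun h0 => absurd (by simp [kd, h]) h0⟩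
    simpa using h2 j (by have := j.2; omega)
  · obtain ⟨ρ, h1, h2⟩ := exists_order (by omega) (x (selI x))
    have e : kd x = min (pc (x (selI x))) 4 := by simp [kd, h]
    refine ⟨ρ, h1, fun h0 => ?_, fun _ j hj => h2 j ?_⟩
    · omega
    · omega

lemma kd_cases {k : ℕ} (x : Fin 3 → Fin k → Bool) :
    kd x = 0 ∨ kd x = 2 ∨ kd x = 3 ∨ kd x = 4 := by
  unfold kd; split_ifs <;> omega

/-- the sample space of signs and variables -/
abbrev LL (n k m : ℕ) := (Fin m → Fin 3 → Fin k → Bool) × (Fin m × Fin 3 × Fin k → Fin n)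

def BL {n k m : ℕ} (s : Fin m → Fin 3 → Fin k → Bool) (v : Fin m × Fin 3 × Fin k → Fin n) : Prop :=
  (∀ i a, Function.Injective fun j => v (i, a, j)) ∧
    ¬ ∃ σ : Fin n → Bool, ∀ i, ∃ j, σ (v (i, selI (s i), j)) = s i (selI (s i)) j

lemma BL_le {n k m : ℕ} (hn : 0 < n) (hk : 7 ≤ k) (s : Fin m → Fin 3 → Fin k → Bool) :
    pr (fun v : Fin m × Fin 3 × Fin k → Fin n => BL s v) ≤
      pr (fun ω : Fin m → Fin 6 → Fin n => BadE (fun i => kd (s i)) ω) := by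
  have : Nonempty (Fin n) := ⟨⟨0, hn⟩⟩
  choose ρ hρ h0 h1 using fun i => exists_rho hk (s i)
  let e : Fin m × Fin 6 → Fin m × Fin 3 × Fin k := fun x => (x.1, selI (s x.1), ρ x.1 x.2)
  have he : Function.Injective e := by
    rintro ⟨i, j⟩ ⟨i', j'⟩ h
    simp only [e, Prod.mk.injEq] at h
    obtain ⟨rfl, -, h⟩ := h
    rw [hρ i h]
  have m1 := Ex_marg (Y := Fin n) e he
    (fun w => ind (BadE (fun i => kd (s i)) (Equiv.curry _ _ _ w)))
  have m2 := Ex_equiv (Equiv.curry (Fin m) (Fin 6) (Fin n))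
    (fun ω => ind (BadE (fun i => kd (s i)) ω))
  unfold pr
  rw [← m2, ← m1]
  apply Ex_mono; intro v
  apply ind_mono
  rintro ⟨hv, hσ⟩
  refine ⟨fun i => ?_, ?_⟩
  · intro j j' h
    exact hρ i (hv i _ h)
  · rintro ⟨σ, g1, g2⟩
    apply hσ
    refine ⟨σ, fun i => ?_⟩
    by_cases hi : kd (s i) = 0
    · obtain ⟨j, hj⟩ := g1 i hi
      exact ⟨ρ i j, by rw [h0 i hi j]; exact hj⟩
    · obtain ⟨j, hj, hj'⟩ := g2 i hi
      exact ⟨ρ i j, by rw [h1 i hi j hj]; exact hj'⟩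

lemma Ex_inj {Ω Ω' : Type*} [Fintype Ω] [Fintype Ω'] [Nonempty Ω] (g : Ω → Ω')
    (hg : Function.Injective g)
    (F : Ω' → ℝ) (hF : ∀ x, 0 ≤ F x) {C : ℝ} (hC : (Fintype.card Ω' : ℝ) ≤ C * Fintype.card Ω) :
    Ex (fun x => F (g x)) ≤ C * Ex F := by
  classical
  have h1 : ∑ x, F (g x) ≤ ∑ y, F y := by
    rw [← Finset.sum_image (s := univ) (g := g) (f := F) (fun a _ b _ h => hg h)]
    exact Finset.sum_le_sum_of_subset_of_nonneg (Finset.subset_univ _) fun y _ _ => hF y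
  have : Nonempty Ω' := ⟨g (Classical.arbitrary Ω)⟩
  have c1 : (0 : ℝ) < Fintype.card Ω := by exact_mod_cast Fintype.card_pos
  have c2 : (0 : ℝ) < Fintype.card Ω' := by exact_mod_cast Fintype.card_pos
  have h0 : 0 ≤ ∑ y, F y := Finset.sum_nonneg fun y _ => hF y
  unfold Ex
  rw [div_le_iff₀ c1]
  calc _ ≤ ∑ y, F y := h1
    _ = (∑ y, F y) / Fintype.card Ω' * Fintype.card Ω' := by field_simp
    _ ≤ (∑ y, F y) / Fintype.card Ω' * (C * Fintype.card Ω) := by gcongr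
    _ = _ := by ring

section
variable {n k : ℕ}

noncomputable def enumC (C : Clause n k) : Fin k ≃ {p // p ∈ C.1} :=
  (C.1.equivFinOfCardEq C.2.1).symm

lemma enumC_fst_inj (C : Clause n k) : Function.Injective fun j => (enumC C j).1.1 := by
  have h : Set.InjOn Prod.fst (C.1 : Set (Lit n)) := by
    rw [← Finset.card_image_iff, C.2.1, C.2.2]
  intro a b hab
  exact (enumC C).injective (Subtype.ext (h (enumC C a).2 (enumC C b).2 hab))

lemma enum_image (C : Clause n k) (π : Equiv.Perm (Fin k)) :
    univ.image (fun j => (enumC C (π j)).1) = C.1 := by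
  ext p
  simp only [mem_image, mem_univ, true_and]
  constructor
  · rintro ⟨j, rfl⟩; exact (enumC C (π j)).2
  · intro hp
    exact ⟨π.symm ((enumC C).symm ⟨p, hp⟩), by simp⟩

lemma enum_pc (C : Clause n k) (π : Equiv.Perm (Fin k)) :
    C.posCount = pc (fun j => (enumC C (π j)).1.2) := by
  unfold Clause.posCount pc
  conv_lhs => rw [← enum_image C π]
  rw [Finset.filter_image, Finset.card_image_of_injective]
  intro a b hab
  exact π.injective ((enumC C).injective (Subtype.ext hab))

lemma enum_sat (C : Clause n k) (π : Equiv.Perm (Fin k)) (σ : Fin n → Bool)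
    (h : ∃ j, σ (enumC C (π j)).1.1 = (enumC C (π j)).1.2) : Sat σ C := by
  obtain ⟨j, hj⟩ := h
  exact ⟨_, (enumC C (π j)).2, hj⟩

lemma select_eq (hl : 0 < 3) (cs : Fin 3 → Clause n k) (x : Fin 3 → Fin k → Bool)
    (hx : ∀ a, (cs a).posCount = pc (x a)) : select hl cs = cs (selI x) := by
  unfold select selI
  have : List.finRange 3 = [0, 1, 2] := by decide
  rw [this]
  by_cases h0 : 2 ≤ pc (x 0)
  · simp [List.find?, hx, h0]
  · by_cases h1 : 2 ≤ pc (x 1)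
    · simp [List.find?, hx, h0, h1]
    · simp [List.find?, hx, h0, h1]

lemma card_clause_ge : n.descFactorial k * 2 ^ k ≤ Fintype.card (Clause n k) * k.factorial := by
  classical
  have key : ∀ x : (Fin k ↪ Fin n) × (Fin k → Bool), ∃ y : Clause n k × Equiv.Perm (Fin k),
      ∀ j, (enumC y.1 (y.2 j)).1 = (x.1 j, x.2 j) := by
    rintro ⟨f, s⟩
    have hinj : Function.Injective fun j => ((f j, s j) : Lit n) := fun a b h =>
      f.injective (congrArg Prod.fst h)
    let C : Clause n k := ⟨univ.image fun j => (f j, s j), by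
      rw [Finset.card_image_of_injective _ hinj]; simp, by
      rw [Finset.image_image]
      have : (Prod.fst ∘ fun j => ((f j, s j) : Lit n)) = f := rfl
      rw [this, Finset.card_image_of_injective _ f.injective]; simp⟩
    have hm : ∀ j, (f j, s j) ∈ C.1 := fun j => Finset.mem_image_of_mem _ (mem_univ j)
    let π0 : Fin k → Fin k := fun j => (enumC C).symm ⟨(f j, s j), hm j⟩
    have hπ : Function.Injective π0 := by
      intro a b hab
      have := (enumC C).symm.injective hab
      exact hinj (congrArg Subtype.val this)
    refine ⟨(C, Equiv.ofBijective π0 (Finite.injective_iff_bijective.1 hπ)), fun j => ?_⟩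
    simp [π0]
  choose h hh using key
  have hinj : Function.Injective h := by
    rintro ⟨f, s⟩ ⟨f', s'⟩ e
    have : ∀ j, (f j, s j) = (f' j, s' j) := fun j => by
      rw [← hh (f, s) j, ← hh (f', s') j, e]
    have e1 : f = f' := by ext j; exact congrArg (fun z => (z.1 : ℕ)) (this j)
    have e2 : s = s' := by ext j; exact congrArg Prod.snd (this j)
    rw [e1, e2]
  have := Fintype.card_le_of_injective h hinj
  simpa [Fintype.card_prod, Fintype.card_embedding_eq, Fintype.card_perm] using this

theorem to_lists {m : ℕ} (hl : 0 < 3) {R : ℝ} (hR0 : 0 ≤ R) [Nonempty (Clause n k)]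
    (hR : (n : ℝ) ^ k ≤ R * n.descFactorial k) :
    pr (fun A : Fin m → Fin 3 → Clause n k => ¬ Satisfiable fun i => select hl (A i)) ≤
      R ^ (3 * m) * pr (fun y : LL n k m => BL y.1 y.2) := by
  classical
  let Ω := (Fin m → Fin 3 → Clause n k) × (Fin m → Fin 3 → Equiv.Perm (Fin k))
  let g : Ω → LL n k m := fun x => (fun i a j => (enumC (x.1 i a) (x.2 i a j)).1.2,
    fun y => (enumC (x.1 y.1 y.2.1) (x.2 y.1 y.2.1 y.2.2)).1.1)
  have hg : Function.Injective g := by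
    rintro ⟨A, π⟩ ⟨A', π'⟩ h
    have h1 : ∀ i a j, (enumC (A i a) (π i a j)).1 = (enumC (A' i a) (π' i a j)).1 := by
      intro i a j
      have e1 := congrFun (congrArg Prod.snd h) (i, a, j)
      have e2 := congrFun (congrFun (congrFun (congrArg Prod.fst h) i) a) j
      exact Prod.ext e1 e2
    have hA : A = A' := by
      funext i a
      apply Subtype.ext
      rw [← enum_image (A i a) (π i a), ← enum_image (A' i a) (π' i a)]
      congr 1; funext j; exact h1 i a j
    subst hA
    have : π = π' := by
      funext i a; ext j
      have := (enumC (A i a)).injective (Subtype.ext (h1 i a j))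
      rw [this]
    rw [this]
  have hcard : (Fintype.card (LL n k m) : ℝ) ≤ R ^ (3 * m) * Fintype.card Ω := by
    have h1 : (Fintype.card (LL n k m) : ℝ) = ((n : ℝ) ^ k * 2 ^ k) ^ (3 * m) := by
      simp only [LL, Fintype.card_prod, Fintype.card_fun, Fintype.card_bool, Fintype.card_fin]
      push_cast
      ring
    have h2 : (Fintype.card Ω : ℝ) =
        ((Fintype.card (Clause n k) : ℝ) * k.factorial) ^ (3 * m) := by
      simp only [Ω, Fintype.card_prod, Fintype.card_fun, Fintype.card_fin, Fintype.card_perm]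
      push_cast
      rw [mul_pow, ← pow_mul, ← pow_mul]
    have h3 : ((n.descFactorial k : ℕ) : ℝ) * 2 ^ k ≤
        (Fintype.card (Clause n k) : ℝ) * k.factorial := by
      exact_mod_cast card_clause_ge (n := n) (k := k)
    rw [h1, h2, ← mul_pow R]
    apply pow_le_pow_left₀ (by positivity)
    calc (n : ℝ) ^ k * 2 ^ k ≤ R * n.descFactorial k * 2 ^ k := by gcongr
      _ = R * (n.descFactorial k * 2 ^ k) := by ring
      _ ≤ _ := by gcongr
  have h1 := Ex_inj g hg (fun y => ind (BL y.1 y.2)) (fun _ => ind_nonneg _) hcard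
  refine le_trans ?_ h1
  rw [Ex_prod]
  apply Ex_mono
  intro A
  calc ind (¬ Satisfiable fun i => select hl (A i)) = Ex (fun _ : Fin m → Fin 3 →
        Equiv.Perm (Fin k) => ind (¬ Satisfiable fun i => select hl (A i))) := (Ex_const _).symm
    _ ≤ _ := by
      apply Ex_mono; intro π
      apply ind_mono
      intro hA
      refine ⟨fun i a => ?_, ?_⟩
      · exact (enumC_fst_inj (A i a)).comp (π i a).injective
      · rintro ⟨σ, hσ⟩
        apply hA
        refine ⟨σ, fun i => ?_⟩
        simp only
        rw [select_eq hl (A i) (fun a j => (enumC (A i a) (π i a j)).1.2)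
          (fun a => enum_pc (A i a) (π i a))]
        exact enum_sat _ (π i _) σ (hσ i)

end

end KS

/-! ### Sign statistics and numerical facts -/

namespace KS

lemma pr_pc_eq (k j : ℕ) : pr (fun z : Fin k → Bool => pc z = j) = (k.choose j : ℝ) / 2 ^ k := by
  classical
  rw [pr_eq]
  have h1 : (univ.filter fun z : Fin k → Bool => pc z = j).card = k.choose j := by
    have : (Finset.powersetCard j (univ : Finset (Fin k))).card = k.choose j := by simp
    rw [← this]
    refine Finset.card_bij' (fun z _ => univ.filter fun i => z i = true)
      (fun s _ i => decide (i ∈ s)) ?_ ?_ ?_ ?_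
    · intro z hz
      have hz' := (Finset.mem_filter.1 hz).2
      exact Finset.mem_powersetCard.2 ⟨Finset.subset_univ _, hz'⟩
    · intro s hs
      have hs' := (Finset.mem_powersetCard.1 hs).2
      refine Finset.mem_filter.2 ⟨mem_univ _, ?_⟩
      simpa [pc] using hs'
    · intro z _; funext i; simp
    · intro s _; ext i; simp
  have h2 : ((univ.filter fun z : Fin k → Bool => pc z = j).card : ℝ) = k.choose j := by
    exact_mod_cast h1
  rw [← h2]; simp
  congr!

lemma pr_true {Ω : Type*} [Fintype Ω] [Nonempty Ω] : pr (fun _ : Ω => True) = 1 := by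
  unfold pr; simp only [ind_true trivial]; exact Ex_const 1

lemma pr_pc_le (k : ℕ) : pr (fun z : Fin k → Bool => pc z ≤ 1) ≤ ((k : ℝ) + 1) / 2 ^ k := by
  calc _ ≤ pr (fun z : Fin k → Bool => pc z = 0 ∨ pc z = 1) := pr_mono fun z hz => by omega
    _ ≤ _ := pr_or _ _
    _ = _ := by rw [pr_pc_eq, pr_pc_eq]; simp; ring

lemma pr_kd0 (k : ℕ) : pr (fun x : Fin 3 → Fin k → Bool => kd x = 0) ≤
    (((k : ℝ) + 1) / 2 ^ k) ^ 3 := by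
  have h1 : ∀ x : Fin 3 → Fin k → Bool, kd x = 0 → ∀ a, pc (x a) ≤ 1 := by
    intro x hx
    have h : pc (x (selI x)) ≤ 1 := by
      unfold kd at hx; split_ifs at hx with h
      · exact h
      · omega
    unfold selI at h
    split_ifs at h with h2 h3
    · omega
    · omega
    · intro a; fin_cases a
      · simpa using by omega
      · simpa using by omega
      · exact h
  refine (pr_mono h1).trans ?_
  rw [pr_pi (fun _ z => pc z ≤ 1), Finset.prod_const]
  simp only [card_univ, Fintype.card_fin]
  exact pow_le_pow_left₀ (pr_nonneg _) (pr_pc_le k) 3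

lemma pr_kdj (k j : ℕ) (hj : j = 2 ∨ j = 3) {q : ℝ} (hq : ((k : ℝ) + 1) / 2 ^ k ≤ q) :
    pr (fun x : Fin 3 → Fin k → Bool => kd x = j) ≤
    (1 + q + q ^ 2) * ((k.choose j : ℝ) / 2 ^ k) := by
  have hq0 : 0 ≤ q := le_trans (by positivity) hq
  have hle := (pr_pc_le k).trans hq
  let G : Fin 3 → Fin 3 → (Fin k → Bool) → Prop := fun c a z =>
    if a < c then pc z ≤ 1 else if a = c then pc z = j else True
  have h1 : ∀ x : Fin 3 → Fin k → Bool, kd x = j → ∃ c, ∀ a, G c a (x a) := by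
    intro x hx
    have h : pc (x (selI x)) = j := by
      unfold kd at hx; split_ifs at hx with h
      · omega
      · omega
    unfold selI at h
    split_ifs at h with h2 h3
    · refine ⟨0, fun a => ?_⟩
      fin_cases a <;> simp [G, h]
    · refine ⟨1, fun a => ?_⟩
      fin_cases a <;> simp [G, h]
      omega
    · refine ⟨2, fun a => ?_⟩
      fin_cases a <;> simp [G, h]
      · omega
      · omega
  refine (pr_mono h1).trans ((pr_exists _).trans ?_)
  have h2 : ∀ c, pr (fun x : Fin 3 → Fin k → Bool => ∀ a, G c a (x a)) = ∏ a, pr (G c a) :=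
    fun c => pr_pi (G c)
  simp only [h2, Fin.sum_univ_three, Fin.prod_univ_three]
  have e : pr (fun z : Fin k → Bool => pc z = j) = (k.choose j : ℝ) / 2 ^ k := pr_pc_eq k j
  have e00 : pr (G 0 0) = (k.choose j : ℝ) / 2 ^ k := by rw [← e]; rfl
  have e01 : pr (G 0 1) = 1 := pr_true
  have e02 : pr (G 0 2) = 1 := pr_true
  have e10 : pr (G 1 0) ≤ q := hle
  have e11 : pr (G 1 1) = (k.choose j : ℝ) / 2 ^ k := by rw [← e]; rfl
  have e12 : pr (G 1 2) = 1 := pr_true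
  have e20 : pr (G 2 0) ≤ q := hle
  have e21 : pr (G 2 1) ≤ q := hle
  have e22 : pr (G 2 2) = (k.choose j : ℝ) / 2 ^ k := by rw [← e]; rfl
  rw [e00, e01, e02, e11, e12, e22]
  have p10 := pr_nonneg (G 1 0)
  have p20 := pr_nonneg (G 2 0)
  have p21 := pr_nonneg (G 2 1)
  set w := (k.choose j : ℝ) / 2 ^ k
  have hw : 0 ≤ w := by positivity
  have m1 : pr (G 1 0) * w ≤ q * w := by gcongr
  have m2 : pr (G 2 0) * pr (G 2 1) * w ≤ q * q * w := by gcongr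
  nlinarith

lemma sign_tail {X : Type} [Fintype X] [Nonempty X] (E : X → Prop) {ρ : ℝ} (hρ : pr E ≤ ρ)
    (s t : ℝ) (hs : 0 ≤ s) (hst : s < t) : ∃ c : ℝ, 0 < c ∧ ∀ n m : ℕ, ρ * m ≤ s * n →
      pr (fun x : Fin m → X => ¬ (∑ i, ind (E (x i)) ≤ t * n)) ≤ Real.exp (-(c * n)) := by
  classical
  obtain ⟨c, hc, H⟩ := tail_exp s (t - s) hs (by linarith)
  refine ⟨c, hc, fun n m hm => ?_⟩
  have h := H (univ : Finset (Fin m)) (fun _ => E) ρ n ((pr_nonneg E).trans hρ) (fun _ _ => hρ)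
    (by simpa using hm)
  refine le_trans (pr_mono fun x hx => ?_) h
  push Not at hx
  rw [show s + (t - s) = t by ring]
  refine le_trans hx.le (le_of_eq ?_)
  rw [Finset.card_filter]; push_cast
  apply Finset.sum_congr rfl; intro i _; unfold ind; split_ifs <;> rfl

lemma num1 (j : ℕ) : ((j : ℝ) + 8) ^ 3 * 32 ≤ 4 ^ (j + 7) := by
  induction j with
  | zero => norm_num
  | succ j ih =>
    rw [show j + 1 + 7 = (j + 7) + 1 by ring, pow_succ _ (j + 7)]
    push_cast
    have h : 0 ≤ 4 * (((j : ℝ) + 8) ^ 3 * 32) - ((j : ℝ) + 1 + 8) ^ 3 * 32 := by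
      ring_nf; positivity
    linarith

lemma num2 (j : ℕ) : ((j : ℝ) + 8) ^ 3 * ((j + 7) * (j + 6)) * 16 ≤ 21 * 4 ^ (j + 7) := by
  induction j with
  | zero => norm_num
  | succ j ih =>
    rw [show j + 1 + 7 = (j + 7) + 1 by ring, pow_succ _ (j + 7)]
    push_cast
    have h : 0 ≤ 4 * (((j : ℝ) + 8) ^ 3 * ((j + 7) * (j + 6)) * 16) -
        ((j : ℝ) + 1 + 8) ^ 3 * ((j + 1 + 7) * (j + 1 + 6)) * 16 := by
      ring_nf; positivity
    linarith

lemma num3 (j : ℕ) : ((j : ℝ) + 8) ^ 6 * ((j + 7) * (j + 6) * (j + 5)) * 1024 ≤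
    210 * 16 ^ (j + 7) := by
  induction j with
  | zero => norm_num
  | succ j ih =>
    rw [show j + 1 + 7 = (j + 7) + 1 by ring, pow_succ _ (j + 7)]
    push_cast
    have h : 0 ≤ 16 * (((j : ℝ) + 8) ^ 6 * ((j + 7) * (j + 6) * (j + 5)) * 1024) -
        ((j : ℝ) + 1 + 8) ^ 6 * ((j + 1 + 7) * (j + 1 + 6) * (j + 1 + 5)) * 1024 := by
      ring_nf; positivity
    linarith

lemma num4 (j : ℕ) : ((j : ℝ) + 8) ^ 9 * 256 ≤ 32 ^ (j + 7) := by
  induction j with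
  | zero => norm_num
  | succ j ih =>
    rw [show j + 1 + 7 = (j + 7) + 1 by ring, pow_succ _ (j + 7)]
    push_cast
    have h : 0 ≤ 32 * (((j : ℝ) + 8) ^ 9 * 256) - ((j : ℝ) + 1 + 8) ^ 9 * 256 := by
      ring_nf; positivity
    linarith

lemma num5 (j : ℕ) : ((j : ℝ) + 8) * 16 ≤ 2 ^ (j + 7) := by
  induction j with
  | zero => norm_num
  | succ j ih =>
    rw [show j + 1 + 7 = (j + 7) + 1 by ring, pow_succ _ (j + 7)]
    push_cast
    have h : 0 ≤ 2 * (((j : ℝ) + 8) * 16) - ((j : ℝ) + 1 + 8) * 16 := by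
      ring_nf; positivity
    linarith

lemma nums (k : ℕ) (hk : 7 ≤ k) (u : ℝ) (hu : u = ((k : ℝ) + 1) ^ 3 / 4 ^ k) :
    0 < u ∧ u ≤ 1 / 32 ∧ u * k.choose 2 ≤ 21 / 32 ∧ u ^ 2 * k.choose 3 ≤ 35 / 1024 ∧
      u ^ 3 * 2 ^ k ≤ 1 / 256 ∧ ((k : ℝ) + 1) / 2 ^ k ≤ 1 / 16 := by
  obtain ⟨j, rfl⟩ := Nat.exists_eq_add_of_le' hk
  have c2 : ((j + 7).choose 2 : ℝ) = (j + 7) * (j + 6) / 2 := by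
    rw [Nat.cast_choose_two]; push_cast; ring
  have c3 : ((j + 7).choose 3 : ℝ) = (j + 7) * (j + 6) * (j + 5) / 6 := by
    have := Nat.descFactorial_eq_factorial_mul_choose (j + 7) 3
    have h2 : (j + 7).descFactorial 3 = (j + 5) * ((j + 6) * (j + 7)) := by
      simp [Nat.descFactorial]
    rw [h2] at this
    have h3 : ((j : ℝ) + 5) * ((j + 6) * (j + 7)) = 6 * ((j + 7).choose 3 : ℝ) := by
      have := congrArg (Nat.cast : ℕ → ℝ) this
      push_cast at this
      rw [this]; norm_num [Nat.factorial]
    linarith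
  have hu' : u = ((j : ℝ) + 8) ^ 3 / 4 ^ (j + 7) := by rw [hu]; push_cast; ring
  have p2 : (0 : ℝ) < 2 ^ (j + 7) := by positivity
  have p4 : (0 : ℝ) < 4 ^ (j + 7) := by positivity
  refine ⟨by rw [hu']; positivity, ?_, ?_, ?_, ?_, ?_⟩
  · rw [hu', div_le_iff₀ p4]; linarith [num1 j]
  · rw [hu', c2, div_mul_eq_mul_div, div_le_iff₀ p4]; linarith [num2 j]
  · rw [hu', c3, div_pow, div_mul_eq_mul_div, div_le_iff₀ (by positivity)]
    have e : ((4 : ℝ) ^ (j + 7)) ^ 2 = 16 ^ (j + 7) := by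
      rw [← pow_mul, mul_comm (j + 7) 2, pow_mul]; norm_num
    rw [e]
    linarith [num3 j]
  · rw [hu', div_pow, div_mul_eq_mul_div, div_le_iff₀ (by positivity)]
    have e : ((4 : ℝ) ^ (j + 7)) ^ 3 = 32 ^ (j + 7) * 2 ^ (j + 7) := by
      rw [← mul_pow, ← pow_mul, mul_comm (j + 7) 3, pow_mul]; norm_num
    rw [e]
    have := mul_le_mul_of_nonneg_right (num4 j) p2.le
    nlinarith
  · rw [div_le_iff₀ p2]; push_cast; linarith [num5 j]

end KS

/-! ### Assembly -/

namespace KS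

lemma desc_bound {n k : ℕ} (hn : 0 < n) (h : 2 * k ≤ n) :
    (n : ℝ) ^ k ≤ Real.exp (2 * k / n) ^ k * n.descFactorial k := by
  have hn' : (0 : ℝ) < n := by exact_mod_cast hn
  have h' : (2 : ℝ) * k ≤ n := by exact_mod_cast h
  have h1 : (n : ℝ) ≤ Real.exp (2 * k / n) * ((n : ℝ) - k) := by
    have h2 : 1 + 2 * k / (n : ℝ) ≤ Real.exp (2 * k / n) := by
      linarith [Real.add_one_le_exp (2 * k / (n : ℝ))]
    have hk0 : (0 : ℝ) ≤ k := by positivity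
    have h3 : (0 : ℝ) ≤ (n : ℝ) - k := by linarith
    calc (n : ℝ) ≤ (1 + 2 * k / (n : ℝ)) * ((n : ℝ) - k) := by
          have e : (1 + 2 * k / (n : ℝ)) * ((n : ℝ) - k) - n = k * (n - 2 * k) / n := by
            field_simp; ring
          have : 0 ≤ k * ((n : ℝ) - 2 * k) / n :=
            div_nonneg (mul_nonneg hk0 (by linarith)) hn'.le
          linarith
      _ ≤ _ := by gcongr
  have h4 : ((n : ℝ) - k) ^ k ≤ n.descFactorial k := by
    have h5 := Nat.pow_sub_le_descFactorial n k
    have h6 : (n - k) ^ k ≤ n.descFactorial k :=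
      le_trans (Nat.pow_le_pow_left (by omega) k) h5
    have h7 : (((n - k : ℕ) : ℝ)) ^ k ≤ n.descFactorial k := by exact_mod_cast h6
    rwa [Nat.cast_sub (by omega)] at h7
  calc (n : ℝ) ^ k ≤ (Real.exp (2 * k / n) * ((n : ℝ) - k)) ^ k := by gcongr
    _ = Real.exp (2 * k / n) ^ k * ((n : ℝ) - k) ^ k := mul_pow _ _ _
    _ ≤ _ := by gcongr

theorem core_k (k : ℕ) (hk : 7 ≤ k) (u : ℝ) (hu : u = ((k : ℝ) + 1) ^ 3 / 4 ^ k) :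
    ∃ ε : ℕ → ℝ, Tendsto ε atTop (nhds 0) ∧ ∀ (n m : ℕ) (kind : Fin m → ℕ), 0 < n →
      (∀ i, kind i = 0 ∨ kind i = 2 ∨ kind i = 3 ∨ kind i = 4) →
      ∑ i, ind (kind i = 0) ≤ (0.6935 * u) * n →
      ∑ i, ind (kind i = 2) ≤ (0.7395 * k.choose 2) * n →
      ∑ i, ind (kind i = 3) ≤ (0.7395 * k.choose 3) * n → (m : ℝ) ≤ (0.6935 * 2 ^ k) * n →
      pr (fun ω : Fin m → Fin 6 → Fin n => BadE kind ω) ≤ ε n := by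
  obtain ⟨u0, u1, u2, u3, u4, -⟩ := nums k hk u hu
  have a2 : 2 * (0.6935 * u) * (0.7395 * k.choose 2) ≤ 0.6732 := by
    calc _ = 2 * 0.6935 * 0.7395 * (u * k.choose 2) := by ring
      _ ≤ 2 * 0.6935 * 0.7395 * (21 / 32) := by gcongr
      _ ≤ _ := by norm_num
  have a20 : 0 ≤ 2 * (0.6935 * u) * (0.7395 * k.choose 2) := by positivity
  have a3 : 4 * (0.6935 * u) ^ 2 * (0.7395 * k.choose 3) +
      8 * (0.6935 * u) ^ 3 * (0.6935 * 2 ^ k) ≤ 0.0559 := by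
    calc _ = 4 * 0.6935 ^ 2 * 0.7395 * (u ^ 2 * k.choose 3) +
          8 * 0.6935 ^ 4 * (u ^ 3 * 2 ^ k) := by ring
      _ ≤ 4 * 0.6935 ^ 2 * 0.7395 * (35 / 1024) + 8 * 0.6935 ^ 4 * (1 / 256) := by gcongr
      _ ≤ _ := by norm_num
  refine core (0.6935 * u) (0.7395 * k.choose 2) (0.7395 * k.choose 3) (0.6935 * 2 ^ k)
    0.717 0.2645 2 1.61 1.36 0.98 (by positivity) (by positivity) (by positivity) (by positivity)
    (by linarith) (by norm_num) (by norm_num) (by norm_num) (by norm_num) (by norm_num)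
    (by norm_num) ?_ ?_ ?_
  · linarith
  · linarith
  · linarith

theorem unsat_lim (k : ℕ) (hk : 7 ≤ k) (hl : 0 < 3) : ∃ ε : ℕ → ℝ, Tendsto ε atTop (nhds 0) ∧
    ∀ᶠ n : ℕ in atTop, pr (fun A : Fin (⌈(2 : ℝ) ^ k * Real.log 2 * n⌉₊) → Fin 3 → Clause n k =>
      ¬ Satisfiable fun i => select hl (A i)) ≤ ε n := by
  classical
  set u : ℝ := ((k : ℝ) + 1) ^ 3 / 4 ^ k with hu
  obtain ⟨ε0, hε0, H⟩ := core_k k hk u hu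
  obtain ⟨u0, -, -, -, -, hq⟩ := nums k hk u hu
  have C2 : (0 : ℝ) < k.choose 2 := by exact_mod_cast Nat.choose_pos (by omega)
  have C3 : (0 : ℝ) < k.choose 3 := by exact_mod_cast Nat.choose_pos (by omega)
  obtain ⟨c0, hc0, H0⟩ := sign_tail _ (pr_kd0 k) (0.6932 * u) (0.6935 * u) (by positivity)
    (by linarith)
  obtain ⟨c2, hc2, H2⟩ := sign_tail _ (pr_kdj k 2 (Or.inl rfl) hq) (0.7393 * k.choose 2)
    (0.7395 * k.choose 2) (by positivity) (by linarith)
  obtain ⟨c3, hc3, H3⟩ := sign_tail _ (pr_kdj k 3 (Or.inr rfl) hq) (0.7393 * k.choose 3)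
    (0.7395 * k.choose 3) (by positivity) (by linarith)
  let Cst : ℝ := Real.exp (6 * k ^ 2 * (0.6935 * 2 ^ k))
  refine ⟨fun n => Cst * (Real.exp (-(c0 * n)) + Real.exp (-(c2 * n)) + Real.exp (-(c3 * n)) +
    |ε0 n|), ?_, ?_⟩
  · have e : ∀ c : ℝ, 0 < c → Tendsto (fun n : ℕ => Real.exp (-(c * n))) atTop (nhds 0) := by
      intro c hc
      apply Real.tendsto_exp_neg_atTop_nhds_zero.comp
      exact tendsto_natCast_atTop_atTop.const_mul_atTop hc
    have h := ((((e c0 hc0).add (e c2 hc2)).add (e c3 hc3)).add hε0.abs).const_mul Cst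
    simpa using h
  filter_upwards [eventually_ge_atTop 20000, eventually_ge_atTop (2 * k)] with n hn1 hn2
  have hn : 0 < n := by omega
  have hn' : (0 : ℝ) < n := by exact_mod_cast hn
  have hn1' : (20000 : ℝ) ≤ n := by exact_mod_cast hn1
  have : Nonempty (Fin n) := ⟨⟨0, hn⟩⟩
  have hne : Nonempty (Clause n k) := by
    have h1 := card_clause_ge (n := n) (k := k)
    have h2 : 0 < n.descFactorial k := Nat.descFactorial_pos.2 (by omega)
    have h3 : 0 < Fintype.card (Clause n k) := by
      by_contra h
      have h0 : Fintype.card (Clause n k) = 0 := by omega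
      rw [h0, zero_mul] at h1
      have : 0 < n.descFactorial k * 2 ^ k := by positivity
      omega
    exact Fintype.card_pos_iff.1 h3
  set m := ⌈(2 : ℝ) ^ k * Real.log 2 * n⌉₊ with hm
  have p2 : (1 : ℝ) ≤ 2 ^ k := one_le_pow₀ (by norm_num)
  have hm1 : (m : ℝ) ≤ 0.6932 * 2 ^ k * n := by
    have h1 : (m : ℝ) < (2 : ℝ) ^ k * Real.log 2 * n + 1 := by
      apply Nat.ceil_lt_add_one
      have := Real.log_nonneg (show (1 : ℝ) ≤ 2 by norm_num)
      positivity
    have h2 : (2 : ℝ) ^ k * Real.log 2 * n ≤ 2 ^ k * 0.69315 * n := by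
      gcongr; linarith [Real.log_two_lt_d9]
    have h3 : (1 : ℝ) ≤ 0.00005 * 2 ^ k * n := by nlinarith
    linarith
  have hm2 : (m : ℝ) ≤ (0.6935 * 2 ^ k) * n := by
    refine hm1.trans ?_
    gcongr; norm_num
  have t0 := H0 n m (by
    have e : (((k : ℝ) + 1) / 2 ^ k) ^ 3 * (0.6932 * 2 ^ k * n) = 0.6932 * u * n := by
      rw [hu]
      have : (4 : ℝ) ^ k = 2 ^ k * 2 ^ k := by rw [← mul_pow]; norm_num
      rw [this]; field_simp
    rw [← e]; gcongr)
  have tj : ∀ j : ℕ, (1 + 1 / 16 + (1 / 16 : ℝ) ^ 2) * ((k.choose j : ℝ) / 2 ^ k) * m ≤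
      0.7393 * k.choose j * n := by
    intro j
    calc _ ≤ (1 + 1 / 16 + (1 / 16 : ℝ) ^ 2) * ((k.choose j : ℝ) / 2 ^ k) *
          (0.6932 * 2 ^ k * n) := by gcongr
      _ = ((1 + 1 / 16 + (1 / 16 : ℝ) ^ 2) * 0.6932) * (k.choose j * n) := by field_simp
      _ ≤ 0.7393 * (k.choose j * n) := by gcongr; norm_num
      _ = _ := by ring
  have t2 := H2 n m (tj 2)
  have t3 := H3 n m (tj 3)
  have hBL : pr (fun y : LL n k m => BL y.1 y.2) ≤ Real.exp (-(c0 * n)) + Real.exp (-(c2 * n)) +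
      Real.exp (-(c3 * n)) + |ε0 n| := by
    unfold pr
    rw [Ex_prod]
    calc _ ≤ Ex (fun s : Fin m → Fin 3 → Fin k → Bool =>
          ind (¬ (∑ i, ind (kd (s i) = 0) ≤ 0.6935 * u * n)) +
          ind (¬ (∑ i, ind (kd (s i) = 2) ≤ 0.7395 * k.choose 2 * n)) +
          ind (¬ (∑ i, ind (kd (s i) = 3) ≤ 0.7395 * k.choose 3 * n)) + |ε0 n|) := by
          apply Ex_mono; intro s
          have hb1 : Ex (fun v : Fin m × Fin 3 × Fin k → Fin n => ind (BL s v)) ≤ 1 :=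
            Ex_le_const fun _ => ind_le_one _
          have n0 := ind_nonneg (¬ (∑ i, ind (kd (s i) = 0) ≤ 0.6935 * u * n))
          have n2 := ind_nonneg (¬ (∑ i, ind (kd (s i) = 2) ≤ 0.7395 * k.choose 2 * n))
          have n3 := ind_nonneg (¬ (∑ i, ind (kd (s i) = 3) ≤ 0.7395 * k.choose 3 * n))
          have nε := abs_nonneg (ε0 n)
          by_cases g0 : ∑ i, ind (kd (s i) = 0) ≤ 0.6935 * u * n
          swap
          · rw [ind_true g0]; linarith
          by_cases g2 : ∑ i, ind (kd (s i) = 2) ≤ 0.7395 * k.choose 2 * n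
          swap
          · rw [ind_true g2]; linarith
          by_cases g3 : ∑ i, ind (kd (s i) = 3) ≤ 0.7395 * k.choose 3 * n
          swap
          · rw [ind_true g3]; linarith
          have hh := (BL_le hn hk s).trans (H n m (fun i => kd (s i)) hn
            (fun i => kd_cases (s i)) g0 g2 g3 hm2)
          unfold pr at hh
          have := le_abs_self (ε0 n)
          linarith
      _ = _ + _ + _ + |ε0 n| := by rw [Ex_add, Ex_add, Ex_add, Ex_const]
      _ ≤ _ := by
          refine add_le_add (add_le_add (add_le_add t0 t2) t3) le_rfl
  have hL := to_lists (n := n) (k := k) (m := m) hl (R := Real.exp (2 * k / n) ^ k)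
    (by positivity) (desc_bound hn hn2)
  refine hL.trans ?_
  have hC : (Real.exp (2 * k / n) ^ k) ^ (3 * m) ≤ Cst := by
    rw [← pow_mul, ← Real.exp_nat_mul]
    apply Real.exp_le_exp.2
    push_cast
    calc (k : ℝ) * (3 * m) * (2 * k / n) = 6 * k ^ 2 * (m / n) := by ring
      _ ≤ _ := by
        gcongr
        rw [div_le_iff₀ hn']; exact hm2
  exact mul_le_mul hC hBL (pr_nonneg _) (by positivity)

lemma unifProb_eq {α : Type*} [Fintype α] (P : α → Prop) : unifProb P = pr P := by
  classical
  rw [pr_eq]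
  unfold unifProb
  rw [Nat.card_eq_fintype_card, Fintype.card_subtype]

end KS

/-- For every integer `k ≥ 7`, the 3-clause Achlioptas rule `select` for random `k`-SAT
(select the first among the first 2 presented clauses with at least two positive literals,
otherwise the 3rd) generates a formula that is satisfiable whp after `⌈2^k * ln 2 * n⌉`
steps. -/
theorem achlioptas_ksat_delay_three_choices (k : ℕ) (hk : 7 ≤ k) :
    Tendsto (fun n : ℕ =>
        unifProb (fun A : Fin (⌈(2 : ℝ) ^ k * Real.log 2 * n⌉₊) → Fin 3 → Clause n k =>
          Satisfiable (fun i => select (by norm_num) (A i))))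
      atTop (nhds 1) := by
  obtain ⟨ε, hε, H⟩ := KS.unsat_lim k hk (by norm_num)
  have h1 : Tendsto (fun n => 1 - ε n) atTop (nhds 1) := by
    simpa using hε.const_sub 1
  have hev : ∀ᶠ n : ℕ in atTop, Nonempty (Clause n k) := by
    filter_upwards [eventually_ge_atTop k] with n hn
    have h1 := KS.card_clause_ge (n := n) (k := k)
    have h2 : 0 < n.descFactorial k := Nat.descFactorial_pos.2 hn
    by_contra h
    rw [not_nonempty_iff] at h
    rw [Fintype.card_eq_zero, zero_mul] at h1
    have : 0 < n.descFactorial k * 2 ^ k := by positivity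
    omega
  refine tendsto_of_tendsto_of_tendsto_of_le_of_le' h1 tendsto_const_nhds ?_ ?_
  · filter_upwards [H, hev] with n hn hne
    rw [KS.unifProb_eq]
    have h2 := KS.pr_or (fun A : Fin (⌈(2 : ℝ) ^ k * Real.log 2 * n⌉₊) → Fin 3 → Clause n k =>
      Satisfiable (fun i => select (by norm_num) (A i)))
      (fun A => ¬ Satisfiable (fun i => select (by norm_num) (A i)))
    have h3 : (1 : ℝ) ≤ KS.pr (fun A : Fin (⌈(2 : ℝ) ^ k * Real.log 2 * n⌉₊) → Fin 3 →
        Clause n k => Satisfiable (fun i => select (by norm_num) (A i)) ∨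
        ¬ Satisfiable (fun i => select (by norm_num) (A i))) := by
      rw [← KS.pr_true (Ω := Fin (⌈(2 : ℝ) ^ k * Real.log 2 * n⌉₊) → Fin 3 → Clause n k)]
      exact KS.pr_mono fun A _ => em _
    linarith
  · filter_upwards [hev] with n hne
    rw [KS.unifProb_eq]
    exact KS.pr_le_one _
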